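/- arXiv:2101.04058 — 4 statements merged into one kernel-verified Lean document; each statement's English description precedes it below -/
import Mathlib

section
/- For all integers n ≥ 0, PD_4(n) ≡ 1 (mod 2) if n = m k² for some nonnegative integers m, k with m dividing 6 (i.e., n is of one of the forms k², 2k², 3k², 6k²), and PD_4(n) ≡ 0 (mod 2) otherwise. -/
/-- `PD k n` is the number of partitions of `n` with designated summands whose parts are
not divisible by `k`: the sum over partitions of `n` with no part divisible by `k` of the
product of the multiplicities of the distinct part sizes. -/
def PD (k n : ℕ) : ℕ :=
  ∑ p : n.Partition,
    if ∀ s ∈ p.parts, ¬ k ∣ s then ∏ s ∈ p.parts.toFinset, p.parts.count s else 0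

open Finset PowerSeries
open scoped PowerSeries.WithPiTopology

section Shanks
variable {R : Type*} [CommRing R] (q : R)

lemma shanks_telescope (n r : ℕ) (hr : r ≤ n) :
    ∑ s ∈ range (r + 1), (∏ k ∈ range s, (1 - q ^ (2 * k + 1))) *
        (∏ k ∈ Ico s n, (1 - q ^ (2 * k + 2))) *
        ((1 - q ^ (2 * n + 2)) * q ^ (s * (2 * n + 3)) -
          (1 - q ^ (2 * n + 1)) * q ^ (s * (2 * n + 1))) =
      (∏ k ∈ range (r + 1), (1 - q ^ (2 * k + 1))) *
        (∏ k ∈ Ico r n, (1 - q ^ (2 * k + 2))) * q ^ ((r + 1) * (2 * n + 1)) := by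
  induction r with
  | zero =>
    simp
    ring
  | succ r ih =>
    rw [sum_range_succ, ih (by omega), prod_eq_prod_Ico_succ_bot (show r < n by omega),
      prod_range_succ _ (r + 1)]
    ring

/-- A finite form, due to Shanks, of Gauss's product formula for the triangular number series. -/
lemma shanks (n : ℕ) :
    (∏ k ∈ range n, (1 - q ^ (2 * k + 1))) *
        ∑ j ∈ range n, (q ^ (j * (2 * j + 1)) + q ^ ((j + 1) * (2 * j + 1))) =
      ∑ s ∈ range n, (∏ k ∈ range s, (1 - q ^ (2 * k + 1))) *
        (∏ k ∈ Ico s n, (1 - q ^ (2 * k + 2))) * q ^ (s * (2 * n + 1)) := by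
  induction n with
  | zero => simp
  | succ n ih =>
    have h1 := shanks_telescope q n n le_rfl
    have h2 : ∀ s ∈ range (n + 1), (∏ k ∈ range s, (1 - q ^ (2 * k + 1))) *
        (∏ k ∈ Ico s (n + 1), (1 - q ^ (2 * k + 2))) * q ^ (s * (2 * (n + 1) + 1)) =
        (1 - q ^ (2 * n + 1)) * ((∏ k ∈ range s, (1 - q ^ (2 * k + 1))) *
          (∏ k ∈ Ico s n, (1 - q ^ (2 * k + 2))) * q ^ (s * (2 * n + 1))) +
        (∏ k ∈ range s, (1 - q ^ (2 * k + 1))) * (∏ k ∈ Ico s n, (1 - q ^ (2 * k + 2))) *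
        ((1 - q ^ (2 * n + 2)) * q ^ (s * (2 * n + 3)) -
          (1 - q ^ (2 * n + 1)) * q ^ (s * (2 * n + 1))) := by
      intro s hs
      rw [prod_Ico_succ_top (by simpa [Nat.lt_succ_iff] using hs)]
      ring
    refine Eq.trans ?_ (sum_congr rfl h2).symm
    refine Eq.trans ?_ sum_add_distrib.symm
    rw [h1, ← mul_sum, sum_range_succ _ n, sum_range_succ _ n, ← ih, prod_range_succ _ n,
      Ico_self, prod_empty]
    ring
end Shanks

lemma two_eq_zero_powerSeries : (2 : (ZMod 2)⟦X⟧) = 0 := by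
  rw [← map_ofNat (C (R := ZMod 2)) 2, show (OfNat.ofNat 2 : ZMod 2) = 0 from rfl, map_zero]

lemma coeff_sq (f : (ZMod 2)⟦X⟧) (n : ℕ) :
    coeff n (f ^ 2) = if 2 ∣ n then coeff (n / 2) f else 0 := by
  have h := MvPowerSeries.map_frobenius_expand (R := ZMod 2) 2 two_ne_zero (f := f)
  rw [ZMod.frobenius_zmod] at h
  rw [← coeff_expand 2 two_ne_zero, ← h]
  congr 1

lemma coeff_pow_four (f : (ZMod 2)⟦X⟧) (n : ℕ) :
    coeff n (f ^ 4) = if 4 ∣ n then coeff (n / 4) f else 0 := by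
  rw [show f ^ 4 = (f ^ 2) ^ 2 by ring, coeff_sq, coeff_sq, Nat.div_div_eq_div_mul]
  split_ifs <;> first | rfl | omega

lemma coeff_pow_eight (f : (ZMod 2)⟦X⟧) (n : ℕ) :
    coeff n (f ^ 8) = if 8 ∣ n then coeff (n / 8) f else 0 := by
  rw [show f ^ 8 = (f ^ 4) ^ 2 by ring, coeff_sq, coeff_pow_four, Nat.div_div_eq_div_mul]
  split_ifs <;> first | rfl | omega

open Classical in
/-- The series `∑ X ^ (m * t)` over the triangular numbers `t`, which are characterised by
`8 * t + 1` being an odd square. -/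
noncomputable def triSeries (m : ℕ) : (ZMod 2)⟦X⟧ :=
  PowerSeries.mk fun n ↦ if ∃ x, Odd x ∧ 8 * n + m = m * x ^ 2 then 1 else 0

lemma coeff_sum_triangular {m : ℕ} (hm : 0 < m) {d n : ℕ} (hdn : d < n) :
    coeff d (∑ j ∈ range n, (((X : (ZMod 2)⟦X⟧) ^ m) ^ (j * (2 * j + 1)) +
      (X ^ m) ^ ((j + 1) * (2 * j + 1)))) = coeff d (triSeries m) := by
  have e1 (j : ℕ) : d = m * (j * (2 * j + 1)) ↔ 8 * d + m = m * (4 * j + 1) ^ 2 := by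
    rw [show m * (4 * j + 1) ^ 2 = 8 * (m * (j * (2 * j + 1))) + m by ring]
    omega
  have e2 (j : ℕ) : d = m * ((j + 1) * (2 * j + 1)) ↔ 8 * d + m = m * (4 * j + 3) ^ 2 := by
    rw [show m * (4 * j + 3) ^ 2 = 8 * (m * ((j + 1) * (2 * j + 1))) + m by ring]
    omega
  simp only [map_sum, map_add, ← pow_mul, coeff_X_pow, e1, e2, triSeries, coeff_mk]
  split_ifs with h
  · obtain ⟨x, hx, h⟩ := h
    have hxd : x ^ 2 ≤ 8 * d + 1 := le_of_mul_le_mul_left (by nlinarith) hm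
    have hxn : x ≤ 4 * n := by nlinarith
    have e (y : ℕ) : 8 * d + m = m * y ^ 2 ↔ x = y := by
      rw [h]
      simp [hm.ne']
    simp only [e]
    rw [sum_eq_single (x / 4)]
    · have := Nat.odd_iff.mp hx
      split_ifs <;> first | omega | simp
    · intro j _ hj
      rw [if_neg (by omega), if_neg (by omega), add_zero]
    · have := Nat.odd_iff.mp hx
      simp only [mem_range]
      omega
  · refine sum_eq_zero fun j _ ↦ ?_
    rw [if_neg fun hj ↦ h ⟨_, ⟨2 * j, by ring⟩, hj⟩,
      if_neg fun hj ↦ h ⟨_, ⟨2 * j + 1, by ring⟩, hj⟩, add_zero]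

open Filter Topology in
lemma hasProd_triSeries {m : ℕ} (hm : 0 < m) :
    ∃ E : (ZMod 2)⟦X⟧, HasProd (fun i ↦ 1 + X ^ (m * (i + 1))) E ∧ E ≠ 0 ∧
      E ^ 3 = triSeries m := by
  have h2 := two_eq_zero_powerSeries
  have hmul : Multipliable fun i ↦ (1 : (ZMod 2)⟦X⟧) + X ^ (m * (i + 1)) := by
    apply WithPiTopology.multipliable_one_add_of_tendsto_order_atTop_nhds_top
    refine ENat.tendsto_nhds_top_iff_natCast_lt.mpr fun n ↦ eventually_atTop.mpr ⟨n, fun k hk ↦ ?_⟩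
    rw [order_X_pow]
    norm_cast
    nlinarith
  obtain ⟨E, hE⟩ := hmul
  have hE0 : E ≠ 0 := by
    rintro rfl
    have h := hE.map (constantCoeff (R := ZMod 2)) (WithPiTopology.continuous_constantCoeff _)
    have h' : (constantCoeff (R := ZMod 2)) ∘ (fun i ↦ (1 : (ZMod 2)⟦X⟧) + X ^ (m * (i + 1))) =
        fun _ ↦ 1 := by
      ext i
      simp [hm.ne']
    rw [h'] at h
    simpa using h.unique hasProd_one
  refine ⟨E, hE, hE0, ?_⟩
  set q : (ZMod 2)⟦X⟧ := X ^ m with hq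
  have hEn : Tendsto (fun n ↦ ∏ k ∈ range n, (1 + q ^ (k + 1))) atTop (𝓝 E) := by
    simpa only [hq, ← pow_mul] using hE.tendsto_prod_nat
  have hψ : Tendsto (fun n ↦ ∑ j ∈ range n, (q ^ (j * (2 * j + 1)) + q ^ ((j + 1) * (2 * j + 1))))
      atTop (𝓝 (triSeries m)) := by
    rw [WithPiTopology.tendsto_iff_coeff_tendsto]
    exact fun d ↦ tendsto_atTop_of_eventually_const (i₀ := d + 1)
      fun n hn ↦ coeff_sum_triangular hm hn
  have hsub (a : (ZMod 2)⟦X⟧) : 1 - a = 1 + a := by linear_combination -a * h2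
  have hfin (n : ℕ) : ∃ r : (ZMod 2)⟦X⟧, (∏ k ∈ range (2 * n), (1 + q ^ (k + 1))) *
      ∑ j ∈ range n, (q ^ (j * (2 * j + 1)) + q ^ ((j + 1) * (2 * j + 1))) =
      (∏ k ∈ range n, (1 + q ^ (k + 1))) ^ 4 + q ^ n * r := by
    have hodd : ∏ k ∈ range (2 * n), (1 + q ^ (k + 1)) =
        (∏ k ∈ range n, (1 + q ^ (2 * k + 1))) * ∏ k ∈ range n, (1 + q ^ (2 * k + 2)) := by
      induction n with
      | zero => simp
      | succ n ih =>
        rw [show 2 * (n + 1) = 2 * n + 1 + 1 by ring, prod_range_succ, prod_range_succ, ih,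
          prod_range_succ, prod_range_succ]
        ring
    have heven : ∏ k ∈ range n, (1 + q ^ (2 * k + 2)) = (∏ k ∈ range n, (1 + q ^ (k + 1))) ^ 2 := by
      rw [← prod_pow]
      refine prod_congr rfl fun k _ ↦ ?_
      linear_combination -q ^ (k + 1) * h2
    have hs := shanks q n
    simp only [hsub] at hs
    rcases n with - | n
    · exact ⟨-1, by simp⟩
    replace hs := hs.trans (sum_range_succ' _ n)
    rw [prod_range_zero] at hs
    have hdvd : q ^ (n + 1) ∣ ∑ s ∈ range n, (∏ k ∈ range (s + 1), (1 + q ^ (2 * k + 1))) *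
        (∏ k ∈ Ico (s + 1) (n + 1), (1 + q ^ (2 * k + 2))) *
          q ^ ((s + 1) * (2 * (n + 1) + 1)) :=
      dvd_sum fun s _ ↦ Dvd.dvd.mul_left (pow_dvd_pow _ (by nlinarith)) _
    obtain ⟨r, hr⟩ := hdvd
    rw [hr, ← range_eq_Ico] at hs
    refine ⟨r * ∏ k ∈ range (n + 1), (1 + q ^ (2 * k + 2)), ?_⟩
    rw [hodd, mul_right_comm, hs, heven]
    ring
  choose r hr using hfin
  have hzero : Tendsto (fun n ↦ q ^ n * r n) atTop (𝓝 0) := by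
    rw [WithPiTopology.tendsto_iff_coeff_tendsto]
    refine fun d ↦ tendsto_atTop_of_eventually_const (i₀ := d + 1) fun n hn ↦ ?_
    rw [hq, ← pow_mul, coeff_X_pow_mul', if_neg (by nlinarith), map_zero]
  have hlim := (hEn.comp (tendsto_id.const_mul_atTop' (r := 2) two_pos)).mul hψ
  have hlim' := (hEn.pow 4).add hzero
  have := tendsto_nhds_unique (hlim.congr hr) hlim'
  refine mul_left_cancel₀ hE0 ?_
  linear_combination -this

/-- The multiplication of `(x + y√-3) / 2` by the cube root of unity that keeps `x` and `y` odd,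
up to signs. -/
def rotate (p : ℕ × ℕ) : ℕ × ℕ :=
  if p.1 % 4 = p.2 % 4 then ((p.1 - 3 * p.2 + (3 * p.2 - p.1)) / 2, (p.1 + p.2) / 2)
  else ((p.1 + 3 * p.2) / 2, (p.1 - p.2 + (p.2 - p.1)) / 2)

/-- The pairs of odd natural numbers with `x ^ 2 + 3 * y ^ 2 = N`. -/
def oddReps (N : ℕ) : Finset (ℕ × ℕ) :=
  {p ∈ range (N + 1) ×ˢ range (N + 1) | Odd p.1 ∧ Odd p.2 ∧ p.1 ^ 2 + 3 * p.2 ^ 2 = N}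

lemma mem_oddReps {N : ℕ} {p : ℕ × ℕ} :
    p ∈ oddReps N ↔ Odd p.1 ∧ Odd p.2 ∧ p.1 ^ 2 + 3 * p.2 ^ 2 = N := by
  simp only [oddReps, mem_filter, mem_product, mem_range, and_iff_right_iff_imp]
  rintro ⟨-, -, h⟩
  constructor <;> nlinarith

lemma rotate_mem_oddReps {N : ℕ} {p : ℕ × ℕ} (hp : p ∈ oddReps N) : rotate p ∈ oddReps N := by
  obtain ⟨x, y⟩ := p
  rw [mem_oddReps] at hp ⊢
  obtain ⟨hx, hy, h⟩ := hp
  rw [Nat.odd_iff] at hx hy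
  simp only [rotate] at h ⊢
  have key (a b : ℤ) (h1 : 2 * a = x - 3 * y ∨ 2 * a = 3 * y - x) (h2 : 2 * b = x + y) :
      a ^ 2 + 3 * b ^ 2 = N := by
    zify at h
    have h1' : (2 * a) ^ 2 = (x - 3 * y : ℤ) ^ 2 := by
      rcases h1 with h1 | h1
      · rw [h1]
      · rw [h1]
        ring
    have : 4 * (a ^ 2 + 3 * b ^ 2) = (4 * N : ℤ) := by
      linear_combination 4 * h + h1' + 3 * (2 * b + x + y) * h2
    omega
  have key' (a b : ℤ) (h1 : 2 * a = x + 3 * y) (h2 : 2 * b = x - y ∨ 2 * b = y - x) :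
      a ^ 2 + 3 * b ^ 2 = N := by
    zify at h
    have h2' : (2 * b) ^ 2 = (x - y : ℤ) ^ 2 := by
      rcases h2 with h2 | h2
      · rw [h2]
      · rw [h2]
        ring
    have : 4 * (a ^ 2 + 3 * b ^ 2) = (4 * N : ℤ) := by
      linear_combination 4 * h + 3 * h2' + (2 * a + x + 3 * y) * h1
    omega
  split_ifs with hxy
  · refine ⟨Nat.odd_iff.mpr (by omega), Nat.odd_iff.mpr (by omega), ?_⟩
    zify
    exact key _ _ (by omega) (by omega)
  · refine ⟨Nat.odd_iff.mpr (by omega), Nat.odd_iff.mpr (by omega), ?_⟩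
    zify
    exact key' _ _ (by omega) (by omega)

lemma rotate_rotate {x y : ℕ} (hx : Odd x) (hy : Odd y) : rotate (rotate (x, y)) = (x, y) := by
  rw [Nat.odd_iff] at hx hy
  simp only [rotate]
  split_ifs <;> simp only [Prod.mk.injEq] at * <;> omega

lemma rotate_eq_self_iff {x y : ℕ} (hx : Odd x) (hy : Odd y) :
    rotate (x, y) = (x, y) ↔ x = y ∨ x = 3 * y := by
  rw [Nat.odd_iff] at hx hy
  simp only [rotate]
  split_ifs <;> simp only [Prod.mk.injEq] <;> omega

open Classical in
lemma card_oddReps (n : ℕ) : ((#(oddReps (8 * n + 4)) : ℕ) : ZMod 2) =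
    (if ∃ x, Odd x ∧ 2 * n + 1 = x ^ 2 then 1 else 0) +
      if ∃ y, Odd y ∧ 2 * n + 1 = 3 * y ^ 2 then 1 else 0 := by
  set S := oddReps (8 * n + 4) with hS
  have hinv : ∑ p ∈ S, ((1 : ZMod 2) + if rotate p = p then 1 else 0) = 0 := by
    refine sum_involution (fun p _ ↦ rotate p) (fun p hp ↦ ?_) (fun p hp h ↦ ?_)
      (fun p hp ↦ rotate_mem_oddReps hp) (fun p hp ↦ ?_)
    · have := mem_oddReps.mp hp
      rw [rotate_rotate this.1 this.2.1]
      simp only [eq_comm (a := p)]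
      exact CharTwo.add_self_eq_zero _
    · contrapose! h
      rw [if_pos h]
      rfl
    · have := mem_oddReps.mp hp
      exact rotate_rotate this.1 this.2.1
  have hsplit : ∑ p ∈ S, (if rotate p = p then (1 : ZMod 2) else 0) =
      ∑ p ∈ S, (if p.1 = p.2 then (1 : ZMod 2) else 0) +
        ∑ p ∈ S, (if p.1 = 3 * p.2 then (1 : ZMod 2) else 0) := by
    rw [← sum_add_distrib]
    refine sum_congr rfl fun ⟨x, y⟩ hp ↦ ?_
    obtain ⟨hx, hy, -⟩ := mem_oddReps.mp hp
    have : 0 < y := hy.pos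
    simp only [rotate_eq_self_iff hx hy]
    split_ifs <;> first | omega | simp
  have h1 : ∑ p ∈ S, (if p.1 = p.2 then (1 : ZMod 2) else 0) =
      if ∃ x, Odd x ∧ 2 * n + 1 = x ^ 2 then 1 else 0 := by
    split_ifs with h
    · obtain ⟨x, hx, h⟩ := h
      rw [sum_eq_single (x, x), if_pos rfl]
      · rintro ⟨a, b⟩ hp hne
        refine if_neg fun hab ↦ hne ?_
        obtain ⟨-, -, hp⟩ := mem_oddReps.mp hp
        obtain rfl : a = b := hab
        have : a ^ 2 = x ^ 2 := by
          simp only at hp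
          omega
        rw [Nat.pow_left_injective two_ne_zero this]
      · exact fun hne ↦ absurd (mem_oddReps.mpr ⟨hx, hx, by simp only; omega⟩) hne
    · refine sum_eq_zero fun p hp ↦ if_neg fun hab ↦ h ?_
      obtain ⟨ho, -, hp⟩ := mem_oddReps.mp hp
      refine ⟨p.1, ho, ?_⟩
      rw [← hab] at hp
      omega
  have h3 : ∑ p ∈ S, (if p.1 = 3 * p.2 then (1 : ZMod 2) else 0) =
      if ∃ y, Odd y ∧ 2 * n + 1 = 3 * y ^ 2 then 1 else 0 := by
    split_ifs with h
    · obtain ⟨x, hx, h⟩ := h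
      rw [sum_eq_single (3 * x, x), if_pos rfl]
      · rintro ⟨a, b⟩ hp hne
        refine if_neg fun hab ↦ hne ?_
        obtain ⟨-, -, hp⟩ := mem_oddReps.mp hp
        obtain rfl : a = 3 * b := hab
        have : b ^ 2 = x ^ 2 := by
          simp only [mul_pow] at hp
          omega
        rw [Nat.pow_left_injective two_ne_zero this]
      · refine fun hne ↦ absurd (mem_oddReps.mpr ⟨Odd.mul (by decide) hx, hx, ?_⟩) hne
        simp only [mul_pow]
        omega
    · refine sum_eq_zero fun p hp ↦ if_neg fun hab ↦ h ?_
      obtain ⟨-, ho, hp⟩ := mem_oddReps.mp hp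
      refine ⟨p.2, ho, ?_⟩
      rw [hab, mul_pow] at hp
      omega
  rw [sum_add_distrib, hsplit, h1, h3, sum_const, nsmul_one] at hinv
  exact CharTwo.add_eq_zero.mp hinv

lemma Odd.sq_mod_eight {x : ℕ} (hx : Odd x) : x ^ 2 % 8 = 1 := by
  have := Nat.odd_iff.mp hx
  rw [Nat.pow_mod]
  have : x % 8 < 8 := Nat.mod_lt _ (by norm_num)
  interval_cases h : x % 8 <;> omega

lemma triSeries_one_mul_triSeries_three :
    triSeries 1 * triSeries 3 = triSeries 1 ^ 4 + X * triSeries 3 ^ 4 := by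
  classical
  ext n
  have hL : coeff n (triSeries 1 * triSeries 3) = ((#(oddReps (8 * n + 4)) : ℕ) : ZMod 2) := by
    rw [coeff_mul, card_eq_sum_ones, Nat.cast_sum]
    simp only [triSeries, coeff_mk, ite_zero_mul_ite_zero, one_mul, Nat.cast_one]
    rw [← sum_filter]
    symm
    refine sum_bij (fun p _ ↦ ((p.1 ^ 2 - 1) / 8, (3 * p.2 ^ 2 - 3) / 8)) ?_ ?_ ?_
      (fun _ _ ↦ rfl)
    · rintro p hp
      obtain ⟨hx, hy, h⟩ := mem_oddReps.mp hp
      have := hx.sq_mod_eight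
      have := hy.sq_mod_eight
      simp only [mem_filter, HasAntidiagonal.mem_antidiagonal]
      exact ⟨by omega, ⟨p.1, hx, by omega⟩, ⟨p.2, hy, by omega⟩⟩
    · rintro ⟨a, b⟩ hp ⟨c, d⟩ hq heq
      obtain ⟨hx, hy, h⟩ := mem_oddReps.mp hp
      obtain ⟨hx', hy', h'⟩ := mem_oddReps.mp hq
      have := hx.sq_mod_eight
      have := hy.sq_mod_eight
      have := hx'.sq_mod_eight
      have := hy'.sq_mod_eight
      simp only [Prod.mk.injEq] at heq this h h' ⊢
      exact ⟨Nat.pow_left_injective two_ne_zero (by simp only at *; omega),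
        Nat.pow_left_injective two_ne_zero (by simp only at *; omega)⟩
    · rintro ⟨i, j⟩ h
      simp only [mem_filter, HasAntidiagonal.mem_antidiagonal] at h
      obtain ⟨hij, ⟨x, hx, h⟩, ⟨y, hy, h'⟩⟩ := h
      refine ⟨(x, y), mem_oddReps.mpr ⟨hx, hy, by simp only; omega⟩, ?_⟩
      simp only [Prod.mk.injEq]
      omega
  rw [hL, card_oddReps, map_add, coeff_pow_four]
  congr 1
  · simp only [triSeries, coeff_mk, ← ite_and]
    refine if_congr ⟨?_, ?_⟩ rfl rfl
    · rintro ⟨x, hx, h⟩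
      have := hx.sq_mod_eight
      exact ⟨by omega, x, hx, by omega⟩
    · rintro ⟨h4, x, hx, h⟩
      exact ⟨x, hx, by omega⟩
  · rcases n with - | n
    · rw [coeff_zero_X_mul, if_neg]
      rintro ⟨y, -, h⟩
      omega
    · rw [coeff_succ_X_mul, coeff_pow_four]
      simp only [triSeries, coeff_mk, ← ite_and]
      refine if_congr ⟨?_, ?_⟩ rfl rfl
      · rintro ⟨x, hx, h⟩
        have := hx.sq_mod_eight
        exact ⟨by omega, x, hx, by omega⟩
      · rintro ⟨h4, x, hx, h⟩
        exact ⟨x, hx, by omega⟩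

/-- `n` is of the form `k ^ 2`, `2 * k ^ 2`, `3 * k ^ 2` or `6 * k ^ 2`. -/
def IsDivisorSixMulSq (n : ℕ) : Prop := ∃ m k : ℕ, m ∣ 6 ∧ n = m * k ^ 2

lemma isDivisorSixMulSq_iff {n : ℕ} : IsDivisorSixMulSq n ↔
    ∃ k, n = k ^ 2 ∨ n = 2 * k ^ 2 ∨ n = 3 * k ^ 2 ∨ n = 6 * k ^ 2 := by
  constructor
  · rintro ⟨m, k, hm, h⟩
    refine ⟨k, ?_⟩
    have := Nat.le_of_dvd (by norm_num) hm
    interval_cases m <;> omega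
  · rintro ⟨k, h | h | h | h⟩
    exacts [⟨1, k, by norm_num, by omega⟩, ⟨2, k, by norm_num, h⟩, ⟨3, k, by norm_num, h⟩,
      ⟨6, k, by norm_num, h⟩]

lemma isDivisorSixMulSq_two_mul {n : ℕ} : IsDivisorSixMulSq (2 * n) ↔ IsDivisorSixMulSq n := by
  have heven {k : ℕ} (h : 2 ∣ k ^ 2) : ∃ l, k = 2 * l := Nat.prime_two.dvd_of_dvd_pow h
  rw [isDivisorSixMulSq_iff, isDivisorSixMulSq_iff]
  constructor
  · rintro ⟨k, h | h | h | h⟩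
    · obtain ⟨l, rfl⟩ := heven ⟨n, h.symm⟩
      exact ⟨l, by grind⟩
    · exact ⟨k, by omega⟩
    · obtain ⟨l, rfl⟩ : ∃ l, k = 2 * l := heven (by omega)
      exact ⟨l, by grind⟩
    · exact ⟨k, by omega⟩
  · rintro ⟨k, h | h | h | h⟩
    exacts [⟨k, by omega⟩, ⟨2 * k, by grind⟩, ⟨k, by omega⟩, ⟨2 * k, by grind⟩]

lemma isDivisorSixMulSq_iff_of_odd {n : ℕ} (hn : ¬ 2 ∣ n) : IsDivisorSixMulSq n ↔
    (∃ k, Odd k ∧ n = k ^ 2) ∨ ∃ k, Odd k ∧ n = 3 * k ^ 2 := by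
  rw [isDivisorSixMulSq_iff]
  have hodd {k : ℕ} (h : ¬ 2 ∣ k ^ 2) : Odd k := by
    rw [← Nat.not_even_iff_odd, even_iff_two_dvd]
    exact fun hk ↦ h (dvd_pow hk two_ne_zero)
  constructor
  · rintro ⟨k, h | h | h | h⟩
    · exact .inl ⟨k, hodd (by omega), h⟩
    · omega
    · exact .inr ⟨k, hodd (by omega), h⟩
    · omega
  · rintro (⟨k, -, h⟩ | ⟨k, -, h⟩)
    exacts [⟨k, by omega⟩, ⟨k, by omega⟩]

open Classical in
lemma coeff_X_mul_triSeries_one_pow_eight (n : ℕ) :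
    coeff n (X * triSeries 1 ^ 8) = if ∃ k, Odd k ∧ n = k ^ 2 then 1 else 0 := by
  rcases n with - | n
  · rw [coeff_zero_X_mul, if_neg]
    rintro ⟨k, hk, h⟩
    have := hk.sq_mod_eight
    omega
  · rw [coeff_succ_X_mul, coeff_pow_eight]
    simp only [triSeries, coeff_mk, ← ite_and]
    refine if_congr ⟨?_, ?_⟩ rfl rfl
    · rintro ⟨h8, x, hx, h⟩
      exact ⟨x, hx, by omega⟩
    · rintro ⟨x, hx, h⟩
      have := hx.sq_mod_eight
      exact ⟨by omega, x, hx, by omega⟩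

open Classical in
lemma coeff_X_pow_three_mul_triSeries_three_pow_eight (n : ℕ) :
    coeff n (X ^ 3 * triSeries 3 ^ 8) = if ∃ k, Odd k ∧ n = 3 * k ^ 2 then 1 else 0 := by
  rw [coeff_X_pow_mul', coeff_pow_eight]
  simp only [triSeries, coeff_mk, ← ite_and]
  refine if_congr ⟨?_, ?_⟩ rfl rfl
  · rintro ⟨h3, h8, x, hx, h⟩
    exact ⟨x, hx, by omega⟩
  · rintro ⟨x, hx, h⟩
    have := hx.sq_mod_eight
    exact ⟨by omega, by omega, x, hx, by omega⟩

open Classical in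
/-- The generating function of the numbers dividing `6` times a square. -/
noncomputable def divisorSixMulSqSeries : (ZMod 2)⟦X⟧ :=
  PowerSeries.mk fun n ↦ if IsDivisorSixMulSq n then 1 else 0

lemma divisorSixMulSqSeries_sq_add_self :
    divisorSixMulSqSeries ^ 2 + divisorSixMulSqSeries =
      X * triSeries 1 ^ 8 + X ^ 3 * triSeries 3 ^ 8 := by
  classical
  ext n
  rw [map_add, map_add, coeff_sq, coeff_X_mul_triSeries_one_pow_eight,
    coeff_X_pow_three_mul_triSeries_three_pow_eight]
  simp only [divisorSixMulSqSeries, coeff_mk]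
  by_cases hn : 2 ∣ n
  · have h1 : ¬ ∃ k, Odd k ∧ n = k ^ 2 := by
      rintro ⟨k, hk, h⟩
      have := hk.sq_mod_eight
      omega
    have h3 : ¬ ∃ k, Odd k ∧ n = 3 * k ^ 2 := by
      rintro ⟨k, hk, h⟩
      have := hk.sq_mod_eight
      omega
    rw [if_neg h1, if_neg h3, if_pos hn]
    obtain ⟨m, rfl⟩ := hn
    rw [Nat.mul_div_cancel_left _ two_pos, isDivisorSixMulSq_two_mul, CharTwo.add_self_eq_zero,
      add_zero]
  · rw [if_neg hn, zero_add, isDivisorSixMulSq_iff_of_odd hn]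
    have hdisj : (∃ k, Odd k ∧ n = k ^ 2) → ¬ ∃ k, Odd k ∧ n = 3 * k ^ 2 := by
      rintro ⟨k, hk, h⟩ ⟨l, hl, h'⟩
      have := hk.sq_mod_eight
      have := hl.sq_mod_eight
      omega
    by_cases h1 : ∃ k, Odd k ∧ n = k ^ 2
    · simp [h1, hdisj h1]
    · simp [h1]

lemma tsum_add_one_smul_pow {s : ℕ} (hs : s ≠ 0) :
    (∑' j, ((j + 1 : ℕ) : ZMod 2) • (X : (ZMod 2)⟦X⟧) ^ (s * (j + 1))) * (1 + X ^ s) ^ 2 =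
      X ^ s := by
  have h2 := two_eq_zero_powerSeries
  have hsum := Nat.Partition.summable_genFun_term' (R := ZMod 2) (fun _ c ↦ (c : ZMod 2)) hs
  have h := hsum.sum_add_tsum_nat_add 2
  have hshift (j : ℕ) : ((j + 2 + 1 : ℕ) : ZMod 2) • (X : (ZMod 2)⟦X⟧) ^ (s * (j + 2 + 1)) =
      X ^ (2 * s) * (((j + 1 : ℕ) : ZMod 2) • (X : (ZMod 2)⟦X⟧) ^ (s * (j + 1))) := by
    rw [mul_smul_comm, ← pow_add]
    congr 1
    · push_cast
      rw [show (2 : ZMod 2) = 0 from rfl, add_zero]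
    · ring
  simp only [hshift] at h
  rw [hsum.tsum_mul_left] at h
  have h0 : ∑ j ∈ range 2, ((j + 1 : ℕ) : ZMod 2) • (X : (ZMod 2)⟦X⟧) ^ (s * (j + 1)) = X ^ s := by
    rw [sum_range_succ, sum_range_one, show ((1 + 1 : ℕ) : ZMod 2) = 0 from rfl]
    simp
  rw [h0] at h
  set S := ∑' j, ((j + 1 : ℕ) : ZMod 2) • (X : (ZMod 2)⟦X⟧) ^ (s * (j + 1))
  linear_combination -h + (S * X ^ s + S * X ^ (2 * s)) * h2

/-- The generating function of `PD 4` modulo `2`. -/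
noncomputable def pdSeries : (ZMod 2)⟦X⟧ := PowerSeries.mk fun n ↦ (PD 4 n : ZMod 2)

lemma pdSeries_eq_genFun :
    pdSeries = Nat.Partition.genFun fun s c ↦ if 4 ∣ s then 0 else (c : ZMod 2) := by
  ext n
  rw [Nat.Partition.coeff_genFun, pdSeries, coeff_mk, PD, Nat.cast_sum]
  refine sum_congr rfl fun p _ ↦ ?_
  rw [Finsupp.prod, Multiset.toFinsupp_support]
  simp only [Multiset.toFinsupp_apply]
  split_ifs with h
  · rw [Nat.cast_prod]
    exact prod_congr rfl fun s hs ↦ (if_neg (h s (Multiset.mem_toFinset.mp hs))).symm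
  · push Not at h
    obtain ⟨s, hs, h4⟩ := h
    rw [Nat.cast_zero]
    symm
    exact prod_eq_zero (i := s) (Multiset.mem_toFinset.mpr hs) (by simp [h4])

lemma hasProd_four_dvd {m : ℕ} {E : (ZMod 2)⟦X⟧}
    (hE : HasProd (fun i ↦ 1 + X ^ (m * (i + 1))) E) :
    HasProd (fun i ↦ if 4 ∣ i + 1 then 1 + X ^ (m * (i + 1)) else 1) (E ^ 4) := by
  have h2 := two_eq_zero_powerSeries
  have hinj : Function.Injective fun i : ℕ ↦ 4 * i + 3 := fun a b h ↦ by
    simp only at h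
    omega
  rw [← hinj.hasProd_iff]
  · convert hE.pow 4 using 2 with i
    simp only [Function.comp_apply]
    rw [if_pos (by omega), show m * (4 * i + 3 + 1) = m * (i + 1) * 4 by ring, pow_mul]
    set a : (ZMod 2)⟦X⟧ := X ^ (m * (i + 1))
    linear_combination -(2 * a + 3 * a ^ 2 + 2 * a ^ 3) * h2
  · intro i hi
    refine if_neg fun h ↦ hi ⟨i / 4, ?_⟩
    simp only
    omega

lemma pdSeries_mul_triSeries_three : pdSeries * triSeries 3 = triSeries 1 ^ 3 := by
  have h2 := two_eq_zero_powerSeries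
  obtain ⟨E, hE, hE0, hEψ⟩ := hasProd_triSeries one_pos
  obtain ⟨F, hF, hF0, hFψ⟩ := hasProd_triSeries three_pos
  have hD := Nat.Partition.hasProd_genFun fun s c ↦ if 4 ∣ s then 0 else (c : ZMod 2)
  rw [← pdSeries_eq_genFun] at hD
  have hL := (hD.mul (hE.pow 3)).mul (hasProd_four_dvd hF)
  have hR := hF.mul ((hasProd_four_dvd hE).pow 3)
  have heq : pdSeries * E ^ 3 * F ^ 4 = F * (E ^ 4) ^ 3 := by
    refine hL.unique (hR.congr_fun fun i ↦ ?_)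
    by_cases h4 : 4 ∣ i + 1
    · simp only [if_pos h4, zero_smul, tsum_zero]
      ring
    · have := tsum_add_one_smul_pow (s := i + 1) (by omega)
      simp only [if_neg h4, one_mul]
      set S := ∑' j, ((j + 1 : ℕ) : ZMod 2) • (X : (ZMod 2)⟦X⟧) ^ ((i + 1) * (j + 1))
      rw [show X ^ (3 * (i + 1)) = ((X : (ZMod 2)⟦X⟧) ^ (i + 1)) ^ 3 by ring]
      set t : (ZMod 2)⟦X⟧ := X ^ (i + 1)
      linear_combination (1 + t) * this + (2 * t + 2 * t ^ 2) * h2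
  rw [← hEψ, ← hFψ]
  refine mul_left_cancel₀ (mul_ne_zero hF0 (pow_ne_zero 3 hE0)) ?_
  linear_combination heq

lemma pdSeries_eq_divisorSixMulSqSeries : pdSeries = divisorSixMulSqSeries := by
  have h2 := two_eq_zero_powerSeries
  have hmod := triSeries_one_mul_triSeries_three
  have hprod := pdSeries_mul_triSeries_three
  have hF := divisorSixMulSqSeries_sq_add_self
  have hB : triSeries 3 ≠ 0 := by
    obtain ⟨F, -, hF0, hFψ⟩ := hasProd_triSeries three_pos
    exact hFψ ▸ pow_ne_zero 3 hF0
  set A := triSeries 1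
  set B := triSeries 3
  set G := pdSeries
  set H := divisorSixMulSqSeries
  have hG : G ^ 2 + G = X * A ^ 8 + X ^ 3 * B ^ 8 := by
    have h1 : G ^ 2 + G = X * (A ^ 4 + X * B ^ 4) ^ 2 := by
      rw [← hmod]
      refine mul_left_cancel₀ (pow_ne_zero 2 hB) ?_
      linear_combination (G * B + A ^ 3 + B) * hprod + A ^ 2 * hmod + A ^ 6 * h2
    linear_combination h1 + X ^ 2 * A ^ 4 * B ^ 4 * h2
  have hzero : (G + H) * (G + H + 1) = 0 := by
    linear_combination hG + hF + (G * H + X * A ^ 8 + X ^ 3 * B ^ 8) * h2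
  rcases mul_eq_zero.mp hzero with h | h
  · linear_combination h - H * h2
  · have h0 := congrArg (coeff 0) h
    have hG0 : coeff 0 G = 1 := by
      simp [G, pdSeries, PD]
    have hH0 : coeff 0 H = 1 := by
      simp only [H, divisorSixMulSqSeries, coeff_mk]
      exact if_pos ⟨1, 0, by norm_num, by norm_num⟩
    rw [map_add, map_add, hG0, hH0, coeff_zero_one] at h0
    exact absurd h0 (by decide)

theorem stmt_8 (n : ℕ) :
    ((∃ m k : ℕ, m ∣ 6 ∧ n = m * k ^ 2) → PD 4 n % 2 = 1) ∧
    ((¬ ∃ m k : ℕ, m ∣ 6 ∧ n = m * k ^ 2) → PD 4 n % 2 = 0) := by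
  classical
  have h := congrArg (coeff n) pdSeries_eq_divisorSixMulSqSeries
  simp only [pdSeries, divisorSixMulSqSeries, coeff_mk] at h
  constructor
  · intro hn
    rw [if_pos (show IsDivisorSixMulSq n from hn), ZMod.natCast_eq_one_iff_odd] at h
    exact Nat.odd_iff.mp h
  · intro hn
    rw [if_neg (show ¬ IsDivisorSixMulSq n from hn), ZMod.natCast_eq_zero_iff_even] at h
    exact Nat.even_iff.mp h
end

section
/- For all integers n ≥ 0, PD_2(2n + 1) ≡ d_n (mod 4), where d_n denotes the number of pairs (j, k) of integers (of either sign) satisfying n = 3j(3j − 1) + 3k(3k − 1). -/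
open PowerSeries PowerSeries.WithPiTopology Filter Topology

section Theta

variable (R : Type*) [CommRing R] {ι κ : Type*}

/-- The series `∑ i, X ^ f i`, for `f` with finite fibres. -/
noncomputable def thetaSeries (f : ι → ℕ) : R⟦X⟧ :=
  .mk fun n ↦ (Nat.card {i // f i = n} : R)

lemma coeff_thetaSeries (f : ι → ℕ) (n : ℕ) :
    (thetaSeries R f).coeff n = Nat.card {i // f i = n} := coeff_mk _ _

lemma thetaSeries_congr {f : ι → ℕ} {g : κ → ℕ} (e : ι ≃ κ) (h : ∀ i, g (e i) = f i) :
    thetaSeries R f = thetaSeries R g := by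
  ext n
  simp_rw [coeff_thetaSeries]
  congr 1
  exact Nat.card_congr (e.subtypeEquiv fun i ↦ by rw [h])

lemma thetaSeries_mul {f : ι → ℕ} {g : κ → ℕ} (hf : ∀ n, Finite {i // f i = n})
    (hg : ∀ n, Finite {i // g i = n}) :
    thetaSeries R f * thetaSeries R g = thetaSeries R fun p : ι × κ ↦ f p.1 + g p.2 := by
  ext n
  simp_rw [coeff_mul, coeff_thetaSeries, ← Nat.cast_mul, ← Nat.cast_sum, ← Nat.card_prod]
  congr 1
  rw [← Finset.sum_coe_sort, ← Nat.card_sigma]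
  exact Nat.card_congr
    { toFun := fun x ↦ ⟨(x.2.1.1, x.2.2.1), by
        have := Finset.HasAntidiagonal.mem_antidiagonal.mp x.1.2
        have h₁ := x.2.1.2
        have h₂ := x.2.2.2
        simp only
        lia⟩
      invFun := fun p ↦ ⟨⟨(f p.1.1, g p.1.2), Finset.HasAntidiagonal.mem_antidiagonal.mpr p.2⟩,
        ⟨p.1.1, rfl⟩, ⟨p.1.2, rfl⟩⟩
      left_inv := by
        rintro ⟨⟨⟨a, b⟩, h⟩, ⟨i, hi⟩, ⟨j, hj⟩⟩
        dsimp only at hi hj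
        subst hi hj
        rfl
      right_inv := fun _ ↦ rfl }

lemma expand_thetaSeries (f : ι → ℕ) {k : ℕ} (hk : k ≠ 0) :
    expand k hk (thetaSeries R f) = thetaSeries R fun i ↦ k * f i := by
  ext n
  rw [coeff_expand]
  split_ifs with h
  · obtain ⟨m, rfl⟩ := h
    simp [coeff_thetaSeries, hk]
  · have : IsEmpty {i // k * f i = n} := ⟨fun i ↦ h ⟨_, i.2.symm⟩⟩
    simp [coeff_thetaSeries]

lemma coeff_thetaSeries_of_injective {f : ι → ℕ} (hf : f.Injective) (i : ι) :
    (thetaSeries R f).coeff (f i) = 1 := by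
  have : Unique {j // f j = f i} := ⟨⟨⟨i, rfl⟩⟩, fun j ↦ Subtype.ext (hf j.2)⟩
  simp [coeff_thetaSeries]

lemma coeff_thetaSeries_eq_zero {f : ι → ℕ} {n : ℕ} (h : n ∉ Set.range f) :
    (thetaSeries R f).coeff n = 0 := by
  have : IsEmpty {i // f i = n} := ⟨fun i ↦ h ⟨_, i.2⟩⟩
  simp [coeff_thetaSeries]

lemma hasSum_thetaSeries [TopologicalSpace R] {f : ι → ℕ} (hf : f.Injective) :
    HasSum (fun i ↦ X ^ f i) (thetaSeries R f) := by
  suffices HasSum ((fun n ↦ C ((thetaSeries R f).coeff n) * X ^ n) ∘ f) (thetaSeries R f) by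
    simpa [Function.comp_def, coeff_thetaSeries_of_injective R hf] using this
  rw [hf.hasSum_iff fun n hn ↦ by simp [coeff_thetaSeries_eq_zero R hn]]
  simpa [monomial_eq_C_mul_X_pow] using (thetaSeries R f).hasSum_of_monomials_self

end Theta

section OddPart

variable {R : Type*} [CommRing R]

/-- The series `∑ n, f (2 n + 1) X ^ n`. -/
noncomputable def oddPart (f : R⟦X⟧) : R⟦X⟧ :=
  .mk fun n ↦ f.coeff (2 * n + 1)

lemma oddPart_expand_two_mul (f g : R⟦X⟧) :
    oddPart (expand 2 two_ne_zero f * g) = f * oddPart g := by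
  ext n
  rw [oddPart, coeff_mk, coeff_mul, coeff_mul]
  symm
  refine Finset.sum_of_injOn (fun p ↦ (2 * p.1, 2 * p.2 + 1)) ?_ ?_ ?_ ?_
  · rintro ⟨a, b⟩ - ⟨c, d⟩ - h
    simp only [Prod.mk.injEq] at h ⊢
    lia
  · rintro ⟨a, b⟩ h
    simp only [Finset.mem_coe, Finset.HasAntidiagonal.mem_antidiagonal] at h ⊢
    lia
  · rintro ⟨a, b⟩ h h'
    have : ¬ 2 ∣ a := by
      rintro ⟨c, rfl⟩
      refine h' ⟨(c, n - c), ?_, ?_⟩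
      all_goals
        simp only [Finset.mem_coe, Finset.HasAntidiagonal.mem_antidiagonal, Prod.mk.injEq] at h ⊢
        lia
    simp [coeff_expand_of_not_dvd _ _ _ this]
  · rintro ⟨a, b⟩ -
    simp [coeff_expand_mul, oddPart]

end OddPart

section Triangular

/-- The triangular numbers `k (2 k - 1)`, each occurring exactly once. -/
def triangular (k : ℤ) : ℕ := (k * (2 * k - 1)).toNat

lemma natCast_triangular (k : ℤ) : (triangular k : ℤ) = k * (2 * k - 1) := by
  rw [triangular, Int.toNat_of_nonneg]
  rcases le_or_gt k 0 with h | h <;> nlinarith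

lemma triangular_injective : Function.Injective triangular := by
  intro x y h
  replace h : (2 * (x + y) - 1) * (x - y) = 0 := by
    have := natCast_triangular x
    have := natCast_triangular y
    grind
  cases mul_eq_zero.mp h <;> grind

lemma finite_fiber_of_injective {ι : Type*} {f : ι → ℕ} (hf : f.Injective) (n : ℕ) :
    Finite {i // f i = n} :=
  have : Subsingleton {i // f i = n} := ⟨fun i j ↦ Subtype.ext (hf (i.2.trans j.2.symm))⟩
  inferInstance

lemma finite_fiber_natAbs_sq (n : ℕ) : Finite {i : ℤ // i.natAbs ^ 2 = n} := by
  refine Set.Finite.to_subtype ((Set.finite_Icc (-n : ℤ) n).subset fun i hi ↦ ?_)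
  have : i.natAbs ≤ n := (Nat.le_self_pow two_ne_zero _).trans_eq hi
  simp only [Set.mem_Icc]
  lia

/-- The change of variables behind `ψ(q)² = φ(q) ψ(q²)`. -/
def squareTriangularEquiv : ℤ × ℤ ≃ ℤ × ℤ where
  toFun p := if 2 ∣ p.1 then (p.2 + p.1 / 2, p.2 - p.1 / 2) else (p.1 / 2 + 1 - p.2, -p.2 - p.1 / 2)
  invFun p := (p.1 - p.2, if 2 ∣ p.1 + p.2 then (p.1 + p.2) / 2 else (1 - p.1 - p.2) / 2)
  left_inv p := by
    ext <;> simp only <;> split_ifs <;> simp_all <;> lia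
  right_inv p := by
    ext <;> simp only <;> split_ifs <;> simp_all <;> lia

lemma thetaSeries_triangular_sq (R : Type*) [CommRing R] :
    thetaSeries R triangular ^ 2 =
      thetaSeries R (fun u : ℤ ↦ u.natAbs ^ 2) *
        expand 2 two_ne_zero (thetaSeries R triangular) := by
  rw [sq, thetaSeries_mul R (finite_fiber_of_injective triangular_injective)
    (finite_fiber_of_injective triangular_injective), expand_thetaSeries,
    thetaSeries_mul R finite_fiber_natAbs_sq (finite_fiber_of_injective fun x y h ↦
      triangular_injective (mul_left_cancel₀ two_ne_zero h))]
  refine (thetaSeries_congr R squareTriangularEquiv fun ⟨u, t⟩ ↦ ?_).symm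
  zify
  simp only [squareTriangularEquiv, Equiv.coe_fn_mk, natCast_triangular, sq_abs]
  obtain ⟨v, rfl | rfl⟩ := Int.even_or_odd' u
  · simp
    ring
  · have h : ¬ (2 : ℤ) ∣ 2 * v + 1 := by lia
    have h' : (2 * v + 1) / 2 = v := by lia
    simp only [h, h', if_false]
    ring

lemma add_emod_two_of_triangular {a b : ℤ} {n : ℕ}
    (h : triangular a + 3 * triangular b = 2 * n + 1) : (a + b) % 2 = 1 := by
  zify at h
  simp only [natCast_triangular] at h
  have : a + b = 2 * (a ^ 2 + 3 * b ^ 2 - b - n - 1) + 1 := by linarith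
  lia

/-- The change of variables behind the odd part of `ψ(q) ψ(q³)`. -/
def oddTriangularEquiv (n : ℕ) :
    {p : ℤ × ℤ // triangular p.1 + 3 * triangular p.2 = 2 * n + 1} ≃
      {p : ℤ × ℤ // p.1.natAbs ^ 2 + 6 * triangular p.2 = n} where
  toFun p := ⟨((p.1.1 + 3 * p.1.2 - 1) / 2, if 4 ∣ p.1.1 - p.1.2 + 1 then (p.1.1 - p.1.2 + 1) / 4
    else (1 - p.1.1 + p.1.2) / 4), by
    obtain ⟨⟨a, b⟩, h⟩ := p
    have hab := add_emod_two_of_triangular h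
    zify at h ⊢
    simp only [natCast_triangular, sq_abs] at h ⊢
    split_ifs with h₄
    · obtain ⟨t, ht⟩ := h₄
      obtain rfl : a = b + 4 * t - 1 := by lia
      have h₁ : (b + 4 * t - 1 + 3 * b - 1) / 2 = 2 * b + 2 * t - 1 := by lia
      have h₂ : (b + 4 * t - 1 - b + 1) / 4 = t := by lia
      rw [h₁, h₂]
      linarith
    · obtain ⟨t, rfl⟩ : ∃ t, a = b + 1 - 4 * t := ⟨(1 - a + b) / 4, by lia⟩
      have h₁ : (b + 1 - 4 * t + 3 * b - 1) / 2 = 2 * b - 2 * t := by lia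
      have h₂ : (1 - (b + 1 - 4 * t) + b) / 4 = t := by lia
      rw [h₁, h₂]
      linarith⟩
  invFun p := ⟨if 2 ∣ p.1.1 then (p.1.1 / 2 + 1 - 3 * p.1.2, p.1.1 / 2 + p.1.2)
    else (p.1.1 / 2 + 3 * p.1.2, p.1.1 / 2 + 1 - p.1.2), by
    obtain ⟨⟨u, t⟩, h⟩ := p
    zify at h ⊢
    simp only [natCast_triangular, sq_abs] at h ⊢
    rw [← h]
    obtain ⟨v, rfl | rfl⟩ := Int.even_or_odd' u
    · simp
      ring
    · have h : ¬ (2 : ℤ) ∣ 2 * v + 1 := by lia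
      have h' : (2 * v + 1) / 2 = v := by lia
      simp only [h, h', if_false]
      ring⟩
  left_inv p := by
    have hab := add_emod_two_of_triangular p.2
    ext <;> simp only <;> split_ifs <;> simp_all <;> lia
  right_inv p := by
    ext <;> simp only <;> split_ifs <;> simp_all <;> lia

lemma oddPart_thetaSeries_triangular (R : Type*) [CommRing R] :
    oddPart (thetaSeries R triangular * expand 3 three_ne_zero (thetaSeries R triangular)) =
      thetaSeries R (fun u : ℤ ↦ u.natAbs ^ 2) *
        expand 6 (by norm_num) (thetaSeries R triangular) := by
  rw [expand_thetaSeries, expand_thetaSeries,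
    thetaSeries_mul R (finite_fiber_of_injective triangular_injective)
      (finite_fiber_of_injective fun x y h ↦
        triangular_injective (mul_left_cancel₀ three_ne_zero h)),
    thetaSeries_mul R finite_fiber_natAbs_sq (finite_fiber_of_injective fun x y h ↦
      triangular_injective (mul_left_cancel₀ (by norm_num) h))]
  ext n
  rw [oddPart, coeff_mk, coeff_thetaSeries, coeff_thetaSeries,
    Nat.card_congr (oddTriangularEquiv n)]

end Triangular

section Gauss

lemma shanks_sum_prod {A : Type*} [CommRing A] (q : A) (u : ℕ → A)
    (hu : ∀ i, u i * (1 - q ^ (2 * i + 1)) = 1) (n : ℕ) :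
    ∑ s ∈ Finset.range n, (∏ i ∈ Finset.Ico s n, (1 - q ^ (2 * i + 2)) * u i) *
        q ^ (s * (2 * n + 1)) =
      ∑ k ∈ Finset.range n, (q ^ (k * (2 * k + 1)) + q ^ ((k + 1) * (2 * k + 1))) := by
  induction n with
  | zero => simp
  | succ n ih =>
    set G : ℕ → A := fun s ↦ (∏ i ∈ Finset.Ico s n, (1 - q ^ (2 * i + 2)) * u i) *
      q ^ (s * (2 * n + 1)) * (1 - q ^ (2 * s)) * u n with hG
    have key : ∀ s ∈ Finset.range n,
        (∏ i ∈ Finset.Ico s (n + 1), (1 - q ^ (2 * i + 2)) * u i) * q ^ (s * (2 * (n + 1) + 1)) =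
        (∏ i ∈ Finset.Ico s n, (1 - q ^ (2 * i + 2)) * u i) * q ^ (s * (2 * n + 1)) +
          (G (s + 1) - G s) := by
      intro s hs
      rw [Finset.mem_range] at hs
      have h₁ := Finset.prod_Ico_succ_top hs.le fun i ↦ (1 - q ^ (2 * i + 2)) * u i
      have h₂ := Finset.prod_eq_prod_Ico_succ_bot hs fun i ↦ (1 - q ^ (2 * i + 2)) * u i
      simp only [hG]
      rw [h₁, h₂]
      set P := ∏ i ∈ Finset.Ico (s + 1) n, (1 - q ^ (2 * i + 2)) * u i
      have hs' := hu s
      have hn' := hu n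
      have e₁ : q ^ (s * (2 * (n + 1) + 1)) = q ^ (s * (2 * n + 1)) * (q ^ s) ^ 2 := by ring
      have e₂ : q ^ ((s + 1) * (2 * n + 1)) = q ^ (s * (2 * n + 1)) * ((q ^ n) ^ 2 * q) := by ring
      have e₃ : q ^ (2 * s + 2) = (q ^ s) ^ 2 * q ^ 2 := by ring
      have e₄ : q ^ (2 * n + 2) = (q ^ n) ^ 2 * q ^ 2 := by ring
      have e₅ : q ^ (2 * s) = (q ^ s) ^ 2 := by ring
      have e₆ : q ^ (2 * s + 1) = (q ^ s) ^ 2 * q := by ring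
      have e₇ : q ^ (2 * n + 1) = (q ^ n) ^ 2 * q := by ring
      rw [e₆] at hs'
      rw [e₇] at hn'
      rw [e₁, e₂, mul_add 2 s 1, mul_one, e₃, e₄, e₅]
      generalize q ^ s = x at *
      generalize q ^ n = y at *
      generalize q ^ (s * (2 * n + 1)) = z at *
      linear_combination (1 - x ^ 2 * q ^ 2) * P * z * (y ^ 2 * q * u n * hs' + u s * hn')
    rw [Finset.sum_range_succ, Finset.sum_congr rfl key, Finset.sum_add_distrib,
      Finset.sum_range_sub, ih, Finset.sum_range_succ, add_assoc]
    congr 1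
    have hn' := hu n
    simp only [hG, Finset.Ico_self, Finset.prod_empty, Nat.Ico_succ_singleton,
      Finset.prod_singleton]
    have e₁ : q ^ (n * (2 * (n + 1) + 1)) = q ^ (n * (2 * n + 1)) * (q ^ n) ^ 2 := by ring
    have e₂ : q ^ ((n + 1) * (2 * n + 1)) = q ^ (n * (2 * n + 1)) * ((q ^ n) ^ 2 * q) := by ring
    rw [e₁, e₂]
    linear_combination q ^ (n * (2 * n + 1)) * (1 + (q ^ n) ^ 2 * q) * hn'

variable (R : Type*) [CommRing R]

lemma continuous_expand [TopologicalSpace R] {k : ℕ} (hk : k ≠ 0) :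
    Continuous (expand k hk : R⟦X⟧ → R⟦X⟧) := by
  refine continuous_iff_continuousAt.mpr fun f ↦ ?_
  rw [ContinuousAt, tendsto_iff_coeff_tendsto]
  intro d
  simp_rw [coeff_expand]
  split_ifs
  · exact (continuous_coeff R _).continuousAt
  · exact tendsto_const_nhds

lemma hasProd_expand_pentagonalSeries [TopologicalSpace R] {k : ℕ} (hk : k ≠ 0) :
    HasProd (fun n ↦ (1 - (X ^ (n + 1)) ^ k : R⟦X⟧)) (expand k hk (pentagonalSeries R)) := by
  refine ((hasProd_one_sub_X_pow R).map (expand k hk) (continuous_expand R hk)).congr_fun ?_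
  intro n
  simp [← pow_mul, mul_comm]

lemma hasSum_triangular [TopologicalSpace R] :
    HasSum (fun k : ℕ ↦ (X ^ (k * (2 * k + 1)) + X ^ ((k + 1) * (2 * k + 1)) : R⟦X⟧))
      (thetaSeries R triangular) := by
  have h := hasSum_thetaSeries R triangular_injective
  rw [← neg_injective.hasSum_iff (fun x hx ↦ by absurd hx; use -x; simp)] at h
  convert h.nat_add_neg_add_one using 4 with k
  · simp only [Function.comp_apply]
    congr 1
    zify
    rw [natCast_triangular]
    ring
  · simp only [Function.comp_apply, neg_neg]
    congr 1
    zify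
    rw [natCast_triangular]
    ring

lemma thetaSeries_triangular_mul_pentagonalSeries :
    thetaSeries R triangular * pentagonalSeries R =
      expand 2 two_ne_zero (pentagonalSeries R) ^ 2 := by
  let : TopologicalSpace R := ⊥
  have : DiscreteTopology R := ⟨rfl⟩
  let u : ℕ → R⟦X⟧ := fun i ↦ invOfUnit (1 - X ^ (2 * i + 1)) 1
  have hu (i : ℕ) : u i * (1 - X ^ (2 * i + 1)) = 1 := by
    rw [mul_comm]
    exact mul_invOfUnit _ _ (by simp)
  have lim : Tendsto (fun n ↦ ∏ i ∈ Finset.range n, (1 - X ^ (2 * i + 2)) * u i) atTop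
      (𝓝 (thetaSeries R triangular)) := by
    rw [tendsto_iff_coeff_tendsto]
    intro d
    refine ((tendsto_iff_coeff_tendsto R _ _ _).mp
      (hasSum_triangular R).tendsto_sum_nat d).congr' ?_
    filter_upwards [eventually_gt_atTop d] with n hn
    obtain ⟨m, rfl⟩ : ∃ m, n = m + 1 := ⟨n - 1, by lia⟩
    rw [← shanks_sum_prod X u hu, Finset.sum_range_succ', map_add, map_sum, Finset.sum_eq_zero]
    · simp
    · intro s _
      rw [coeff_mul_X_pow', if_neg]
      nlinarith
  have lim₂ := (hasProd_expand_pentagonalSeries R two_ne_zero).tendsto_prod_nat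
  have lim₁ := (hasProd_one_sub_X_pow R).tendsto_prod_nat.comp
    (tendsto_id.const_mul_atTop' two_pos)
  refine tendsto_nhds_unique (lim.mul lim₁) ((lim₂.pow 2).congr fun n ↦ ?_)
  have split : ∏ i ∈ Finset.range (2 * n), (1 - X ^ (i + 1) : R⟦X⟧) =
      ∏ i ∈ Finset.range n, (1 - X ^ (2 * i + 1)) * (1 - X ^ (2 * i + 2)) := by
    induction n with
    | zero => simp
    | succ n ih => rw [mul_add, mul_one, Finset.prod_range_succ, Finset.prod_range_succ, ih,
        Finset.prod_range_succ, mul_assoc]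
  simp only [Function.comp_apply, id_eq]
  rw [split, ← Finset.prod_mul_distrib, ← Finset.prod_pow]
  refine Finset.prod_congr rfl fun i _ ↦ ?_
  linear_combination -(1 - X ^ (2 * i + 2)) ^ 2 * hu i

end Gauss

section GeneratingFunction

open Nat.Partition

variable (R : Type*) [CommRing R]

/-- The generating function of partitions with designated summands. -/
noncomputable def designatedSeries : R⟦X⟧ := genFun fun _ c ↦ (c : R)

/-- The generating function of partitions with designated summands and odd parts. -/
noncomputable def oddDesignatedSeries : R⟦X⟧ := genFun fun i c ↦ if 2 ∣ i then 0 else (c : R)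

lemma coeff_oddDesignatedSeries (n : ℕ) : (oddDesignatedSeries R).coeff n = PD 2 n := by
  rw [oddDesignatedSeries, coeff_genFun, PD, Nat.cast_sum]
  refine Finset.sum_congr rfl fun p _ ↦ ?_
  rw [Finsupp.prod, Multiset.toFinsupp_support]
  simp only [Multiset.toFinsupp_apply]
  split_ifs with h
  · rw [Nat.cast_prod]
    exact Finset.prod_congr rfl fun s hs ↦ if_neg (h s (Multiset.mem_toFinset.mp hs))
  · push Not at h
    obtain ⟨s, hs, h₂⟩ := h
    rw [Nat.cast_zero]
    exact Finset.prod_eq_zero (Multiset.mem_toFinset.mpr hs) (if_pos h₂)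

variable [TopologicalSpace R]

/-- The factor of `designatedSeries` belonging to parts of size `i`. -/
noncomputable def designatedFactor (i : ℕ) : R⟦X⟧ :=
  1 + ∑' j : ℕ, ((j + 1 : ℕ) : R) • X ^ (i * (j + 1))

lemma hasProd_designatedSeries [T2Space R] :
    HasProd (fun i ↦ designatedFactor R (i + 1)) (designatedSeries R) := by
  simpa only [designatedFactor, designatedSeries] using hasProd_genFun fun _ c ↦ (c : R)

lemma hasProd_oddDesignatedSeries [T2Space R] :
    HasProd (fun i ↦ if 2 ∣ i + 1 then 1 else designatedFactor R (i + 1))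
      (oddDesignatedSeries R) := by
  refine (hasProd_genFun fun i c ↦ if 2 ∣ i then 0 else (c : R)).congr_fun fun i ↦ ?_
  split_ifs with h
  · simp
  · simp [designatedFactor]

lemma expand_two_designatedFactor [T2Space R] (i : ℕ) (hi : i ≠ 0) :
    expand 2 two_ne_zero (designatedFactor R i) = designatedFactor R (2 * i) := by
  have hS := summable_genFun_term' (fun _ c ↦ (c : R)) hi
  rw [designatedFactor, designatedFactor, map_add, map_one,
    hS.map_tsum (expand 2 two_ne_zero) (continuous_expand R two_ne_zero)]
  simp [← pow_mul, mul_assoc]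

variable [IsTopologicalRing R] [T2Space R]

lemma designatedFactor_mul_sq {i : ℕ} (hi : i ≠ 0) :
    designatedFactor R i * (1 - X ^ i) ^ 2 = 1 - X ^ i + X ^ (2 * i) := by
  have hS := summable_genFun_term' (fun _ c ↦ (c : R)) hi
  have hT := summable_genFun_term' (fun _ _ ↦ (1 : R)) hi
  simp only [one_smul] at hT
  have eT := hT.tsum_eq_zero_add
  have eS := hS.tsum_eq_zero_add
  have eT' : ∑' j : ℕ, (X : R⟦X⟧) ^ (i * (j + 1 + 1)) = X ^ i * ∑' j : ℕ, X ^ (i * (j + 1)) := by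
    rw [← hT.tsum_mul_left]
    exact tsum_congr fun j ↦ by ring
  have eS' : ∑' j : ℕ, ((j + 1 + 1 : ℕ) : R) • (X : R⟦X⟧) ^ (i * (j + 1 + 1)) =
      X ^ i * (∑' j : ℕ, ((j + 1 : ℕ) : R) • X ^ (i * (j + 1)) + ∑' j : ℕ, X ^ (i * (j + 1))) := by
    rw [← hS.tsum_add hT, ← (hS.add hT).tsum_mul_left]
    refine tsum_congr fun j ↦ ?_
    rw [Nat.cast_succ (j + 1), add_smul, one_smul, smul_eq_C_mul, smul_eq_C_mul]
    ring
  rw [eT'] at eT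
  rw [eS'] at eS
  simp only [zero_add, mul_one, Nat.cast_one, one_smul] at eT eS
  rw [designatedFactor]
  set S := ∑' j : ℕ, ((j + 1 : ℕ) : R) • (X : R⟦X⟧) ^ (i * (j + 1))
  set T := ∑' j : ℕ, (X : R⟦X⟧) ^ (i * (j + 1))
  linear_combination (1 - X ^ i) * eS + X ^ i * eT

lemma oddDesignatedSeries_mul :
    oddDesignatedSeries R * expand 2 two_ne_zero (designatedSeries R) = designatedSeries R := by
  have h := (hasProd_designatedSeries R).map (expand 2 two_ne_zero)
    (continuous_expand R two_ne_zero)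
  have inj : Function.Injective fun i : ℕ ↦ 2 * i + 1 := fun i j h ↦ by simpa using h
  have h₂ : HasProd (fun i ↦ if 2 ∣ i + 1 then designatedFactor R (i + 1) else 1)
      (expand 2 two_ne_zero (designatedSeries R)) := by
    rw [← inj.hasProd_iff]
    · refine h.congr_fun fun i ↦ ?_
      rw [Function.comp_apply, Function.comp_apply, expand_two_designatedFactor R _ i.succ_ne_zero,
        if_pos (by lia)]
      congr 1
    · intro n hn
      exact if_neg fun ⟨c, hc⟩ ↦ hn ⟨c - 1, by simp only; lia⟩
  refine ((hasProd_oddDesignatedSeries R).mul h₂).unique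
    ((hasProd_designatedSeries R).congr_fun fun i ↦ ?_)
  split_ifs <;> simp

lemma designatedSeries_mul :
    designatedSeries R * (pentagonalSeries R * expand 2 two_ne_zero (pentagonalSeries R) *
      expand 3 three_ne_zero (pentagonalSeries R)) =
        expand 6 (by norm_num) (pentagonalSeries R) := by
  refine ((hasProd_designatedSeries R).mul (((hasProd_one_sub_X_pow R).mul
    (hasProd_expand_pentagonalSeries R two_ne_zero)).mul
    (hasProd_expand_pentagonalSeries R three_ne_zero))).unique
    ((hasProd_expand_pentagonalSeries R (by norm_num)).congr_fun fun i ↦ ?_)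
  have h := designatedFactor_mul_sq R i.succ_ne_zero
  rw [mul_comm 2, pow_mul] at h
  set y : R⟦X⟧ := X ^ (i + 1)
  linear_combination (1 + y) * (1 - y ^ 3) * h

end GeneratingFunction

section Congruence

lemma isUnit_expand_pentagonalSeries (R : Type*) [CommRing R] {k : ℕ} (hk : k ≠ 0) :
    IsUnit (expand k hk (pentagonalSeries R)) := by
  rw [isUnit_iff_constantCoeff, constantCoeff_expand, ← coeff_zero_eq_constantCoeff_apply]
  have h := coeff_pentagonalSeries_pentagonal R 0
  rw [show pentagonal 0 = 0 by simp [pentagonal_def]] at h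
  simp [h]

lemma four_eq_zero : (4 : (ZMod 4)⟦X⟧) = 0 := by
  have : (4 : ZMod 4) = 0 := rfl
  rw [← map_ofNat (C : ZMod 4 →+* (ZMod 4)⟦X⟧) 4, this, map_zero]

lemma expand_two_pentagonalSeries_sq :
    expand 2 two_ne_zero (pentagonalSeries (ZMod 4)) ^ 2 = pentagonalSeries (ZMod 4) ^ 4 := by
  have h₁ := hasProd_one_sub_X_pow (ZMod 4)
  have h₂ := hasProd_expand_pentagonalSeries (ZMod 4) two_ne_zero
  rw [sq, show 4 = 2 * 2 from rfl, pow_mul, sq, sq]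
  refine (h₂.mul h₂).unique (((h₁.mul h₁).mul (h₁.mul h₁)).congr_fun fun i ↦ ?_)
  linear_combination (1 - X ^ (i + 1)) ^ 2 * X ^ (i + 1) * four_eq_zero

lemma pentagonalSeries_sq :
    pentagonalSeries (ZMod 4) ^ 2 = thetaSeries (ZMod 4) pentagonal ^ 2 := by
  obtain ⟨d, hd⟩ : (2 : (ZMod 4)⟦X⟧) ∣
      pentagonalSeries (ZMod 4) - thetaSeries (ZMod 4) pentagonal := by
    refine ⟨.mk fun n ↦ if (pentagonalSeries (ZMod 4)).coeff n = -1 then 1 else 0, ?_⟩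
    ext n
    rw [← map_ofNat (C : ZMod 4 →+* (ZMod 4)⟦X⟧) 2, coeff_C_mul, coeff_mk, map_sub]
    by_cases h : n ∈ Set.range pentagonal
    · obtain ⟨k, rfl⟩ := h
      rw [coeff_thetaSeries_of_injective _ pentagonal_injective, coeff_pentagonalSeries_pentagonal]
      rcases Int.even_or_odd k with hk | hk
      · simp [Int.negOnePow_even k hk]
        decide
      · simp [Int.negOnePow_odd k hk]
        decide
    · rw [coeff_thetaSeries_eq_zero _ h, coeff_pentagonalSeries_eq_zero _ h]
      decide
  rw [sub_eq_iff_eq_add.mp hd]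
  linear_combination (d ^ 2 + d * thetaSeries (ZMod 4) pentagonal) * four_eq_zero

lemma thetaSeries_triangular_eq_cube :
    thetaSeries (ZMod 4) triangular = pentagonalSeries (ZMod 4) ^ 3 := by
  have h := isUnit_expand_pentagonalSeries (ZMod 4) one_ne_zero
  rw [expand_one_apply] at h
  refine h.mul_right_cancel ?_
  rw [thetaSeries_triangular_mul_pentagonalSeries, expand_two_pentagonalSeries_sq]
  ring

lemma oddDesignatedSeries_mul_pentagonalSeries (R : Type*) [CommRing R] :
    oddDesignatedSeries R * (pentagonalSeries R * expand 3 three_ne_zero (pentagonalSeries R) *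
      expand 12 (by norm_num) (pentagonalSeries R)) =
    expand 4 four_ne_zero (pentagonalSeries R) *
      expand 6 (by norm_num) (pentagonalSeries R) ^ 2 := by
  let : TopologicalSpace R := ⊥
  have : DiscreteTopology R := ⟨rfl⟩
  have h := oddDesignatedSeries_mul R
  have h₁ := designatedSeries_mul R
  have h₂ := congrArg (expand 2 two_ne_zero) h₁
  simp only [map_mul, ← expand_mul, Nat.reduceMul] at h₂
  refine (isUnit_expand_pentagonalSeries R two_ne_zero).mul_right_cancel ?_
  set F₂ := expand 2 two_ne_zero (pentagonalSeries R)
  set F₃ := expand 3 three_ne_zero (pentagonalSeries R)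
  set F₄ := expand 4 four_ne_zero (pentagonalSeries R)
  set F₆ := expand 6 (by norm_num) (pentagonalSeries R)
  linear_combination -oddDesignatedSeries R * pentagonalSeries R * F₂ * F₃ * h₂ +
    pentagonalSeries R * F₂ * F₃ * F₂ * F₄ * F₆ * h + F₂ * F₄ * F₆ * h₁

lemma oddPart_oddDesignatedSeries_mul (R : Type*) [CommRing R] :
    pentagonalSeries R ^ 2 * expand 6 (by norm_num) (pentagonalSeries R) *
      oddPart (oddDesignatedSeries R) =
    expand 2 two_ne_zero (pentagonalSeries R) * (thetaSeries R (fun u : ℤ ↦ u.natAbs ^ 2) *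
      expand 6 (by norm_num) (thetaSeries R triangular)) := by
  rw [← oddPart_thetaSeries_triangular, ← oddPart_expand_two_mul, ← oddPart_expand_two_mul]
  congr 1
  simp only [map_mul, map_pow, ← expand_mul, Nat.reduceMul]
  have h := oddDesignatedSeries_mul_pentagonalSeries R
  have h₁ := thetaSeries_triangular_mul_pentagonalSeries R
  have h₃ := congrArg (expand 3 three_ne_zero) h₁
  simp only [map_mul, map_pow, ← expand_mul, Nat.reduceMul] at h₃
  have u₁ := isUnit_expand_pentagonalSeries R one_ne_zero
  rw [expand_one_apply] at u₁
  refine (u₁.mul (isUnit_expand_pentagonalSeries R three_ne_zero)).mul_right_cancel ?_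
  set F₂ := expand 2 two_ne_zero (pentagonalSeries R)
  set F₃ := expand 3 three_ne_zero (pentagonalSeries R)
  set F₄ := expand 4 four_ne_zero (pentagonalSeries R)
  set F₆ := expand 6 (by norm_num) (pentagonalSeries R)
  linear_combination F₂ ^ 2 * h -
    F₄ * expand 3 three_ne_zero (thetaSeries R triangular) * F₃ * h₁ - F₄ * F₂ ^ 2 * h₃

lemma oddPart_oddDesignatedSeries :
    oddPart (oddDesignatedSeries (ZMod 4)) =
      expand 6 (by norm_num) (pentagonalSeries (ZMod 4)) ^ 2 := by
  have h := oddPart_oddDesignatedSeries_mul (ZMod 4)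
  have h' := thetaSeries_triangular_sq (ZMod 4)
  rw [thetaSeries_triangular_eq_cube, map_pow] at h h'
  have u₁ := isUnit_expand_pentagonalSeries (ZMod 4) one_ne_zero
  have u₂ := isUnit_expand_pentagonalSeries (ZMod 4) two_ne_zero
  have u₆ := isUnit_expand_pentagonalSeries (ZMod 4) (k := 6) (by norm_num)
  rw [expand_one_apply] at u₁
  refine (((u₁.pow 6).mul u₂).mul u₆).mul_left_cancel ?_
  have h₂ := expand_two_pentagonalSeries_sq
  set F := pentagonalSeries (ZMod 4)
  set F₂ := expand 2 two_ne_zero F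
  set F₆ := expand 6 (by norm_num) F
  linear_combination F₂ ^ 3 * h - F₂ * F₆ ^ 3 * h' -
    F ^ 2 * F₆ * F₂ * oddPart (oddDesignatedSeries (ZMod 4)) * h₂

end Congruence

theorem stmt_10 (n : ℕ) :
    PD 2 (2 * n + 1) ≡
      Nat.card {p : ℤ × ℤ //
        (n : ℤ) = 3 * p.1 * (3 * p.1 - 1) + 3 * p.2 * (3 * p.2 - 1)} [MOD 4] := by
  rw [← ZMod.natCast_eq_natCast_iff, ← coeff_oddDesignatedSeries]
  have h := congrArg (coeff n) oddPart_oddDesignatedSeries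
  rw [oddPart, coeff_mk, ← map_pow, pentagonalSeries_sq, map_pow, expand_thetaSeries, sq,
    thetaSeries_mul, coeff_thetaSeries] at h
  · rw [h]
    congr 1
    refine Nat.card_congr (Equiv.subtypeEquivRight fun ⟨j, k⟩ ↦ ?_)
    have hj := two_mul_natCast_pentagonal j
    have hk := two_mul_natCast_pentagonal k
    zify
    constructor <;> intro h <;> linarith
  all_goals
    exact finite_fiber_of_injective fun x y h ↦
      pentagonal_injective (mul_left_cancel₀ (by norm_num) h)
end

section
/- For all integers n ≥ 0, PD_2(2n) ≡ ε_n + 2·A_n + B_n (mod 4), where ε_n = 1 if n = 0 and ε_n = 0 otherwise, A_n is the number of integers k ≥ 1 with 3 ∤ k and n = k², and B_n is the number of ordered pairs (k, ℓ) of integers with k ≥ 1, ℓ ≥ 1, 3 ∤ k, 3 ∤ ℓ, and n = k² + ℓ². -/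
open PowerSeries Finset
open scoped PowerSeries.WithPiTopology

/-- The triangular number `k (k + 1) / 2`. -/
def tri (k : ℤ) : ℕ := (k * (k + 1) / 2).toNat

theorem two_mul_tri (k : ℤ) : 2 * (tri k : ℤ) = k * (k + 1) := by
  have h : 0 ≤ k * (k + 1) := by
    rcases le_or_gt 0 k with h | h
    · positivity
    · exact mul_nonneg_of_nonpos_of_nonpos h.le (by lia)
  rw [tri, Int.toNat_of_nonneg (by positivity)]
  exact Int.mul_ediv_cancel' (Int.even_mul_succ_self k).two_dvd

theorem tri_sub_one (k : ℤ) : (tri k : ℤ) = tri (k - 1) + k := by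
  have h₁ := two_mul_tri k
  have h₂ := two_mul_tri (k - 1)
  linarith

section FiniteProduct

variable {A : Type*} [CommRing A]

/-- The finite `q`-Pochhammer product `(q; q)_m`. -/
def qPoch (q : A) (m : ℕ) : A := ∏ j ∈ range m, (1 - q ^ (j + 1))

/-- The inverse of `(q; q)_m`, extended by zero to negative `m`. -/
noncomputable def qPochInv (q : A) (m : ℤ) : A :=
  if m < 0 then 0 else Ring.inverse (qPoch q m.toNat)

theorem qPochInv_of_neg (q : A) {m : ℤ} (hm : m < 0) : qPochInv q m = 0 := if_pos hm

theorem qPoch_mul_qPochInv {q : A} (hq : ∀ m, IsUnit (qPoch q m)) (m : ℕ) :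
    qPoch q m * qPochInv q m = 1 := by
  simp [qPochInv, Ring.mul_inverse_cancel _ (hq m)]

theorem qPochInv_eq {q : A} (hq : ∀ m, IsUnit (qPoch q m)) (m : ℤ) :
    qPochInv q m = (1 - q ^ (m + 1).toNat) * qPochInv q (m + 1) := by
  rcases lt_trichotomy m (-1) with h | rfl | h
  · rw [qPochInv_of_neg q (by lia), qPochInv_of_neg q (by lia), mul_zero]
  · simp [qPochInv]
  · lift m to ℕ using (by lia)
    have h₁ := qPoch_mul_qPochInv hq m
    have h₂ := qPoch_mul_qPochInv hq (m + 1)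
    have h₃ : qPoch q (m + 1) = qPoch q m * (1 - q ^ (m + 1)) := prod_range_succ _ _
    rw [show ((m : ℤ) + 1).toNat = m + 1 by lia]
    push_cast at h₂
    rw [h₃] at h₂
    apply (hq m).mul_left_cancel
    rw [h₁, ← mul_assoc, h₂]

/-- The right-hand side of the finite form of the Jacobi triple product. -/
noncomputable def tripleSum (x y : A) (a b : ℕ) : A :=
  ∑ i ∈ range (a + b + 1), qPochInv (x * y) i * qPochInv (x * y) (a + b - i) *
    (x ^ tri (i - b) * y ^ tri (b - i))

theorem tripleSum_comm (x y : A) (a b : ℕ) : tripleSum x y a b = tripleSum y x b a := by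
  rw [tripleSum, ← sum_range_reflect, tripleSum, add_comm b a, mul_comm y x]
  refine sum_congr rfl fun i hi ↦ ?_
  have hi : i ≤ a + b := by simpa [Nat.lt_succ_iff] using hi
  rw [show ((a + b + 1 - 1 - i : ℕ) : ℤ) = a + b - i by lia,
    show (a + b - (a + b - i) : ℤ) = i by ring, show (a + b - i - b : ℤ) = a - i by ring,
    show (b - (a + b - i) : ℤ) = i - a by ring, show (b + a - i : ℤ) = a + b - i by ring]
  ring

theorem tripleSum_succ {x y : A} (hq : ∀ m, IsUnit (qPoch (x * y) m)) (a b : ℕ) :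
    (1 + x * (x * y) ^ a) * tripleSum x y a b =
      (1 - (x * y) ^ (a + b + 1)) * tripleSum x y (a + 1) b := by
  set q := x * y with hqdef
  let F : ℕ → A := fun i ↦ qPochInv q i * qPochInv q (a + b - i) *
    (x ^ tri (i - b) * y ^ tri (b - i))
  let H : ℕ → A := fun i ↦ qPochInv q (i - 1) * qPochInv q (a + b + 1 - i) *
    (x ^ tri (i - b - 1) * y ^ tri (b + 1 - i)) * (x * q ^ a)
  have hF : tripleSum x y a b = ∑ i ∈ range (a + b + 2), F i := by
    rw [sum_range_succ, tripleSum]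
    simp [F, qPochInv_of_neg, ← hqdef]
  have hH : x * q ^ a * tripleSum x y a b = ∑ i ∈ range (a + b + 2), H i := by
    rw [sum_range_succ', tripleSum, mul_sum]
    have h0 : H 0 = 0 := by simp [H, qPochInv_of_neg]
    rw [h0, add_zero]
    refine sum_congr rfl fun i _ ↦ ?_
    simp only [H, ← hqdef]
    push_cast
    rw [show (i + 1 - 1 : ℤ) = i by ring, show (a + b + 1 - (i + 1) : ℤ) = a + b - i by ring,
      show (i + 1 - b - 1 : ℤ) = i - b by ring, show (b + 1 - (i + 1) : ℤ) = b - i by ring]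
    ring
  rw [add_mul, one_mul, hH, hF, ← sum_add_distrib, tripleSum, mul_sum,
    show a + 1 + b + 1 = a + b + 2 by ring]
  refine sum_congr rfl fun i hi ↦ ?_
  have hi : i ≤ a + b + 1 := by simpa [Nat.lt_succ_iff] using hi
  simp only [F, H, ← hqdef]
  push_cast
  have h₁ := qPochInv_eq hq (a + b - i)
  have h₂ := qPochInv_eq hq (i - 1)
  rw [show (a + b - i + 1 : ℤ) = a + b + 1 - i by ring,
    show (a + b + 1 - i : ℤ).toNat = a + b + 1 - i by lia] at h₁
  rw [show (i - 1 + 1 : ℤ) = i by ring, Int.toNat_natCast] at h₂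
  have ht : x ^ tri (i - b - 1) * y ^ tri (b + 1 - i) * (x * q ^ a) =
      q ^ (a + b + 1 - i) * (x ^ tri (i - b) * y ^ tri (b - i)) := by
    have e₁ := tri_sub_one (i - b)
    have e₂ := tri_sub_one (b + 1 - i)
    rw [show (b + 1 - i - 1 : ℤ) = b - i by ring] at e₂
    have e₃ : tri (i - b - 1) + (1 + a) = a + b + 1 - i + tri (i - b) := by lia
    have e₄ : tri (b + 1 - i) + a = a + b + 1 - i + tri (b - i) := by lia
    rw [hqdef, mul_pow, mul_pow]
    calc _ = x ^ (tri (i - b - 1) + (1 + a)) * y ^ (tri (b + 1 - i) + a) := by ring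
      _ = _ := by rw [e₃, e₄]; ring
  rw [h₁, h₂, show (a + 1 + b - i : ℤ) = a + b + 1 - i by ring]
  have hp : q ^ (a + b + 1) = q ^ (a + b + 1 - i) * q ^ i := by
    rw [← pow_add]; congr 1; lia
  rw [hp]
  linear_combination (1 - q ^ i) * qPochInv q i * qPochInv q (a + b + 1 - i) * ht

theorem prod_mul_prod_eq_tripleSum {x y : A} (hq : ∀ m, IsUnit (qPoch (x * y) m)) (a b : ℕ) :
    (∏ j ∈ range a, (1 + x * (x * y) ^ j)) * ∏ j ∈ range b, (1 + y * (x * y) ^ j) =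
      qPoch (x * y) (a + b) * tripleSum x y a b := by
  have step (x y : A) (hq : ∀ m, IsUnit (qPoch (x * y) m)) (a b : ℕ)
      (h : (∏ j ∈ range a, (1 + x * (x * y) ^ j)) * ∏ j ∈ range b, (1 + y * (x * y) ^ j) =
        qPoch (x * y) (a + b) * tripleSum x y a b) :
      (∏ j ∈ range (a + 1), (1 + x * (x * y) ^ j)) * ∏ j ∈ range b, (1 + y * (x * y) ^ j) =
        qPoch (x * y) (a + 1 + b) * tripleSum x y (a + 1) b := by
    have hs := tripleSum_succ hq a b
    have h₃ : qPoch (x * y) (a + 1 + b) = qPoch (x * y) (a + b) * (1 - (x * y) ^ (a + b + 1)) := by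
      rw [show a + 1 + b = a + b + 1 by ring]; exact prod_range_succ _ _
    rw [prod_range_succ, h₃]
    linear_combination (1 + x * (x * y) ^ a) * h + qPoch (x * y) (a + b) * hs
  induction a with
  | zero =>
    induction b with
    | zero => simp [tripleSum, qPoch, qPochInv, tri]
    | succ b ih =>
      have := step y x (by rwa [mul_comm]) b 0
        (by rw [mul_comm y x, ← tripleSum_comm, add_comm b 0, ← ih, mul_comm])
      rw [mul_comm, mul_comm x y, this, tripleSum_comm y x, add_zero, zero_add]
  | succ a ih => exact step x y hq a b ih

end FiniteProduct

section InfiniteProduct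

variable {R : Type*} [CommRing R] [TopologicalSpace R]

/-- The infinite product `∏ (1 + c X ^ (a + b n))` over `n ≥ 0`. -/
noncomputable def prodSeries (c : R) (a b : ℕ) : R⟦X⟧ := ∏' n : ℕ, (1 + C c * X ^ (a + b * n))

theorem multipliable_prodSeries (c : R) (a : ℕ) {b : ℕ} (hb : 0 < b) :
    Multipliable fun n : ℕ ↦ (1 + C c * X ^ (a + b * n) : R⟦X⟧) := by
  apply WithPiTopology.multipliable_one_add_of_tendsto_order_atTop_nhds_top
  refine ENat.tendsto_nhds_top_iff_natCast_lt.mpr fun n ↦ Filter.eventually_atTop.mpr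
    ⟨n + 1, fun m hm ↦ ?_⟩
  refine lt_of_lt_of_le (Nat.cast_lt.mpr (show n < a + b * m by nlinarith)) ?_
  refine le_order _ _ fun i hi ↦ ?_
  rw [coeff_C_mul_X_pow, if_neg]
  exact (Nat.cast_lt.mp hi).ne

variable [T2Space R]

omit [T2Space R] in
theorem tendsto_prodSeries (c : R) (a : ℕ) {b : ℕ} (hb : 0 < b) :
    Filter.Tendsto (fun n ↦ ∏ i ∈ range n, (1 + C c * X ^ (a + b * i) : R⟦X⟧)) Filter.atTop
      (nhds (prodSeries c a b)) :=
  (multipliable_prodSeries c a hb).hasProd.tendsto_prod_nat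

theorem constantCoeff_prodSeries (c : R) {a b : ℕ} (ha : 0 < a) (hb : 0 < b) :
    constantCoeff (prodSeries c a b) = 1 := by
  refine tendsto_nhds_unique
    (((WithPiTopology.continuous_constantCoeff R).tendsto _).comp (tendsto_prodSeries c a hb)) ?_
  refine tendsto_const_nhds.congr fun n ↦ ?_
  simp [map_prod, ha.ne']

theorem prodSeries_ne_zero [Nontrivial R] (c : R) {a b : ℕ} (ha : 0 < a) (hb : 0 < b) :
    prodSeries c a b ≠ 0 := fun h ↦ by
  have := constantCoeff_prodSeries c ha hb
  simp [h] at this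

variable [IsTopologicalRing R]

theorem prodSeries_eq_mul (c : R) (a : ℕ) {b : ℕ} (hb : 0 < b) :
    prodSeries c a b = prodSeries c a (2 * b) * prodSeries c (a + b) (2 * b) := by
  refine tendsto_nhds_unique
    ((tendsto_prodSeries c a hb).comp (Filter.tendsto_id.const_mul_atTop' (two_pos)))
    (((tendsto_prodSeries c a (by lia)).mul (tendsto_prodSeries c (a + b) (by lia))).congr
      fun n ↦ ?_)
  simp only [Function.comp, id]
  induction n with
  | zero => simp
  | succ n ih =>
    rw [prod_range_succ, prod_range_succ, show 2 * (n + 1) = 2 * n + 1 + 1 by ring,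
      prod_range_succ, prod_range_succ, ← ih]
    ring_nf

theorem prodSeries_eq_mul_mul (c : R) (a : ℕ) {b : ℕ} (hb : 0 < b) :
    prodSeries c a b =
      prodSeries c a (3 * b) * prodSeries c (a + b) (3 * b) * prodSeries c (a + 2 * b) (3 * b) := by
  refine tendsto_nhds_unique
    ((tendsto_prodSeries c a hb).comp (Filter.tendsto_id.const_mul_atTop' (three_pos)))
    ((((tendsto_prodSeries c a (by lia)).mul (tendsto_prodSeries c (a + b) (by lia))).mul
      (tendsto_prodSeries c (a + 2 * b) (by lia))).congr fun n ↦ ?_)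
  simp only [Function.comp, id]
  induction n with
  | zero => simp
  | succ n ih =>
    rw [prod_range_succ, prod_range_succ, prod_range_succ,
      show 3 * (n + 1) = 3 * n + 1 + 1 + 1 by ring,
      prod_range_succ, prod_range_succ, prod_range_succ, ← ih]
    ring_nf

theorem prodSeries_one_mul_neg_one (a : ℕ) {b : ℕ} (hb : 0 < b) :
    prodSeries (1 : R) a b * prodSeries (-1) a b = prodSeries (-1) (2 * a) (2 * b) := by
  rw [prodSeries, prodSeries, prodSeries,
    ← (multipliable_prodSeries _ _ hb).tprod_mul (multipliable_prodSeries _ _ hb)]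
  refine tprod_congr fun n ↦ ?_
  simp only [map_neg, map_one]
  ring

omit [T2Space R] [IsTopologicalRing R] in
theorem continuous_expand_s11 {p : ℕ} (hp : p ≠ 0) :
    Continuous (PowerSeries.expand p hp : R⟦X⟧ → R⟦X⟧) := by
  refine continuous_iff_continuousAt.mpr fun f ↦ ?_
  refine (WithPiTopology.tendsto_iff_coeff_tendsto R _ _ _).mpr fun d ↦ ?_
  simp only [PowerSeries.coeff_expand]
  split_ifs
  · exact (WithPiTopology.continuous_coeff R _).tendsto f
  · exact tendsto_const_nhds

omit [IsTopologicalRing R] in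
theorem expand_prodSeries {p : ℕ} (hp : p ≠ 0) (c : R) (a : ℕ) {b : ℕ} (hb : 0 < b) :
    PowerSeries.expand p hp (prodSeries c a b) = prodSeries c (p * a) (p * b) := by
  rw [prodSeries, (multipliable_prodSeries c a hb).map_tprod _ (continuous_expand_s11 hp)]
  refine tprod_congr fun n ↦ ?_
  rw [map_add, map_mul, map_pow, map_one, PowerSeries.expand_C, PowerSeries.expand_X, ← pow_mul]
  ring_nf

end InfiniteProduct

/-- The generating function of the number of solutions `i` to `e i = n`. -/
noncomputable def countSeries (R : Type*) [Semiring R] {ι : Type*} (e : ι → ℕ) : R⟦X⟧ :=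
  PowerSeries.mk fun n ↦ (Nat.card {i // e i = n} : R)

/-- The exponents of Ramanujan's theta function `f(X ^ u, X ^ v)`. -/
def thetaExp (u v : ℕ) (k : ℤ) : ℕ := u * tri k + v * tri (-k)

theorem natAbs_le_thetaExp {u v : ℕ} (hu : 0 < u) (hv : 0 < v) (k : ℤ) :
    k.natAbs ≤ thetaExp u v k := by
  have h₁ := two_mul_tri k
  have h₂ := two_mul_tri (-k)
  have h₃ : tri k + tri (-k) ≤ thetaExp u v k := by unfold thetaExp; nlinarith
  have h₄ : k.natAbs ≤ k.natAbs * k.natAbs := Nat.le_mul_self _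
  zify at *
  rw [abs_mul_abs_self] at h₄
  linarith

section TripleProduct

variable {R : Type*} [CommRing R]

theorem X_pow_dvd_countSeries_sub {u v : ℕ} (hu : 0 < u) (hv : 0 < v) {d n : ℕ} (hn : d ≤ n) :
    (X : R⟦X⟧) ^ d ∣
      countSeries R (thetaExp u v) - ∑ i ∈ range (2 * n + 1), X ^ thetaExp u v (i - n) := by
  rw [X_pow_dvd_iff]
  intro m hm
  simp only [countSeries, map_sub, coeff_mk, map_sum, coeff_X_pow, sum_boole, sub_eq_zero]
  congr 1
  have hinj : Function.Injective fun i : ℕ ↦ (i : ℤ) - n := fun i j h ↦ by simpa using h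
  rw [← card_image_of_injective _ hinj]
  refine Nat.subtype_card _ fun k ↦ ?_
  simp only [mem_image, mem_filter, mem_range]
  constructor
  · rintro ⟨i, ⟨-, hi⟩, rfl⟩
    exact hi.symm
  · intro hk
    have := natAbs_le_thetaExp hu hv k
    refine ⟨(k + n).toNat, ⟨by lia, ?_⟩, by lia⟩
    rw [Int.toNat_of_nonneg (by lia), add_sub_cancel_right, hk]

variable [TopologicalSpace R] [DiscreteTopology R]

theorem eventually_X_pow_dvd (c : R) (a : ℕ) {b : ℕ} (hb : 0 < b) (d : ℕ) :
    ∀ᶠ n in Filter.atTop,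
      X ^ d ∣ ∏ i ∈ range n, (1 + C c * X ^ (a + b * i) : R⟦X⟧) - prodSeries c a b := by
  have h := (WithPiTopology.tendsto_iff_coeff_tendsto R _ _ _).mp (tendsto_prodSeries c a hb)
  have h' : ∀ m ∈ range d, ∀ᶠ n in Filter.atTop,
      coeff m (∏ i ∈ range n, (1 + C c * X ^ (a + b * i) : R⟦X⟧)) =
        coeff m (prodSeries c a b) := fun m _ ↦ by
    have := h m
    rwa [nhds_discrete, Filter.tendsto_pure] at this
  filter_upwards [(Filter.eventually_all_finset _).mpr h'] with n hn
  rw [X_pow_dvd_iff]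
  intro m hm
  rw [map_sub, hn m (by simpa using hm), sub_self]

/-- The Jacobi triple product identity. -/
theorem countSeries_thetaExp {u v : ℕ} (hu : 0 < u) (hv : 0 < v) :
    countSeries R (thetaExp u v) =
      prodSeries 1 u (u + v) * prodSeries 1 v (u + v) * prodSeries (-1) (u + v) (u + v) := by
  have hs : 0 < u + v := by lia
  suffices ∀ d, (X : R⟦X⟧) ^ d ∣ prodSeries 1 u (u + v) * prodSeries 1 v (u + v) *
      prodSeries (-1) (u + v) (u + v) - countSeries R (thetaExp u v) by
    rw [eq_comm, ← sub_eq_zero]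
    ext m
    exact X_pow_dvd_iff.mp (this (m + 1)) m (by lia)
  intro d
  obtain ⟨n₀, hn₀⟩ := Filter.eventually_atTop.mp
    (((eventually_X_pow_dvd (1 : R) u hs d).and (eventually_X_pow_dvd (1 : R) v hs d)).and
      (eventually_X_pow_dvd (-1 : R) (u + v) hs d))
  set n := n₀ + d with hn
  let π := Ideal.Quotient.mk (Ideal.span {(X : R⟦X⟧) ^ d})
  have hπ (f g : R⟦X⟧) : X ^ d ∣ f - g ↔ π f = π g := by
    rw [Ideal.Quotient.mk_eq_mk_iff_sub_mem, Ideal.mem_span_singleton]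
  simp only [hπ] at hn₀
  rw [hπ]
  have hθ := X_pow_dvd_countSeries_sub (R := R) hu hv (show d ≤ n by lia)
  rw [hπ] at hθ
  set x : R⟦X⟧ := X ^ u
  set y : R⟦X⟧ := X ^ v
  have hxy : x * y = X ^ (u + v) := (pow_add _ _ _).symm
  have hpoch (m : ℕ) : qPoch (x * y) m =
      ∏ i ∈ range m, (1 + C (-1) * X ^ (u + v + (u + v) * i) : R⟦X⟧) := by
    refine prod_congr rfl fun i _ ↦ ?_
    rw [hxy, map_neg, map_one]
    ring
  have hunit (m : ℕ) : IsUnit (qPoch (x * y) m) := by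
    rw [isUnit_iff_constantCoeff, hpoch]
    simp [map_prod, hu.ne']
  have hfin := congrArg π (prod_mul_prod_eq_tripleSum hunit n n)
  have hx : ∏ j ∈ range n, (1 + x * (x * y) ^ j) =
      ∏ j ∈ range n, (1 + C 1 * X ^ (u + (u + v) * j) : R⟦X⟧) :=
    prod_congr rfl fun i _ ↦ by rw [hxy, map_one]; ring
  have hy : ∏ j ∈ range n, (1 + y * (x * y) ^ j) =
      ∏ j ∈ range n, (1 + C 1 * X ^ (v + (u + v) * j) : R⟦X⟧) :=
    prod_congr rfl fun i _ ↦ by rw [hxy, map_one]; ring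
  have hE (m : ℕ) (hm : n₀ ≤ m) :
      π (qPoch (x * y) m) = π (prodSeries (-1) (u + v) (u + v)) := by
    rw [hpoch, (hn₀ m hm).2]
  have hI (m : ℕ) (hm : n₀ ≤ m) :
      π (prodSeries (-1) (u + v) (u + v)) * π (qPochInv (x * y) m) = 1 := by
    rw [← hE m hm, ← map_mul, qPoch_mul_qPochInv hunit, map_one]
  rw [hx, hy, map_mul, map_mul, (hn₀ n (by lia)).1.1, (hn₀ n (by lia)).1.2,
    hE (n + n) (by lia)] at hfin
  rw [map_mul, map_mul, hfin, hθ, tripleSum, map_sum, map_sum, mul_sum, sum_mul, two_mul]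
  refine sum_congr rfl fun i hi ↦ ?_
  have hi : i ≤ n + n := by simpa [Nat.lt_succ_iff] using hi
  have ht : x ^ tri (i - n) * y ^ tri (n - i) = X ^ thetaExp u v (i - n) := by
    rw [thetaExp, neg_sub, pow_add, pow_mul, pow_mul]
  rw [ht]
  by_cases hk : ((i : ℤ) - n).natAbs < d
  · have h₁ := hI i (by lia)
    have h₂ := hI (n + n - i) (by lia)
    rw [Nat.cast_sub hi, Nat.cast_add] at h₂
    rw [map_mul, map_mul]
    linear_combination π (X ^ thetaExp u v (i - n)) *
      (π (prodSeries (-1) (u + v) (u + v)) * π (qPochInv (x * y) (n + n - i)) * h₁ + h₂)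
  · have h0 : π (X ^ thetaExp u v (i - n)) = 0 := by
      rw [Ideal.Quotient.eq_zero_iff_mem, Ideal.mem_span_singleton]
      exact pow_dvd_pow _ ((not_lt.mp hk).trans (natAbs_le_thetaExp hu hv _))
    rw [map_mul, h0, mul_zero, mul_zero, zero_mul]

end TripleProduct

section CountSeries

variable {R : Type*} [Semiring R] {ι κ : Type*}

theorem countSeries_comp_equiv (e : κ → ℕ) (σ : ι ≃ κ) :
    countSeries R (e ∘ σ) = countSeries R e := by
  ext n
  simp only [countSeries, coeff_mk]
  congr 1
  exact Nat.card_congr (σ.subtypeEquiv fun _ ↦ Iff.rfl)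

theorem countSeries_add_one (e : ι → ℕ) :
    countSeries R (fun i ↦ e i + 1) = X * countSeries R e := by
  ext n
  cases n with
  | zero => simp [countSeries]
  | succ n => simp [countSeries, coeff_succ_X_mul]

theorem countSeries_sumElim (e₁ : ι → ℕ) (e₂ : κ → ℕ) (h₁ : ∀ n, Finite {i // e₁ i = n})
    (h₂ : ∀ n, Finite {i // e₂ i = n}) :
    countSeries R (Sum.elim e₁ e₂) = countSeries R e₁ + countSeries R e₂ := by
  ext n
  simp only [countSeries, coeff_mk, map_add]
  have := h₁ n
  have := h₂ n
  rw [Nat.card_congr (Equiv.subtypeSum (p := fun i ↦ Sum.elim e₁ e₂ i = n)), ← Nat.cast_add]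
  exact congrArg Nat.cast (Nat.card_sum (α := {i // e₁ i = n}) (β := {j // e₂ j = n}))

theorem countSeries_mul (e₁ : ι → ℕ) (e₂ : κ → ℕ) (h₁ : ∀ n, Finite {i // e₁ i = n})
    (h₂ : ∀ n, Finite {i // e₂ i = n}) :
    countSeries R e₁ * countSeries R e₂ = countSeries R (fun p : ι × κ ↦ e₁ p.1 + e₂ p.2) := by
  ext n
  simp only [countSeries, coeff_mk, coeff_mul]
  let σ : {p : ι × κ // e₁ p.1 + e₂ p.2 = n} ≃
      (x : antidiagonal n) × ({i // e₁ i = x.1.1} × {j // e₂ j = x.1.2}) :=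
    { toFun p := ⟨⟨(e₁ p.1.1, e₂ p.1.2), by simpa using p.2⟩, ⟨p.1.1, rfl⟩, ⟨p.1.2, rfl⟩⟩
      invFun y := ⟨(y.2.1.1, y.2.2.1), by
        rw [y.2.1.2, y.2.2.2]; exact mem_antidiagonal.mp y.1.2⟩
      left_inv p := rfl
      right_inv := by
        rintro ⟨⟨⟨a, b⟩, h⟩, ⟨i, hi⟩, ⟨j, hj⟩⟩
        simp only at hi hj
        subst hi hj
        rfl }
  rw [Nat.card_congr σ, Nat.card_sigma]
  simp only [Nat.card_prod]
  push_cast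
  exact (sum_coe_sort (antidiagonal n)
    fun x ↦ (Nat.card {i // e₁ i = x.1} : R) * (Nat.card {j // e₂ j = x.2} : R)).symm

end CountSeries

theorem finite_thetaExp_fiber {u v : ℕ} (hu : 0 < u) (hv : 0 < v) (n : ℕ) :
    Finite {k // thetaExp u v k = n} :=
  (Set.finite_Icc (-n : ℤ) n).subset fun k (hk : thetaExp u v k = n) ↦ by
    have := natAbs_le_thetaExp hu hv k
    exact ⟨by lia, by lia⟩

theorem two_mul_thetaExp (u v : ℕ) (k : ℤ) :
    2 * (thetaExp u v k : ℤ) = u * (k * (k + 1)) + v * (k * (k - 1)) := by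
  have h₁ := two_mul_tri k
  have h₂ := two_mul_tri (-k)
  rw [thetaExp]
  push_cast
  linear_combination u * h₁ + v * h₂

/-- The `3`-dissection of `ψ(q) = f(q, q³)`. -/
theorem countSeries_thetaExp_one_three (R : Type*) [Semiring R] :
    countSeries R (thetaExp 1 3) =
      countSeries R (thetaExp 3 6) + X * countSeries R (thetaExp 9 27) := by
  let f : ℤ ⊕ ℤ → ℤ :=
    Sum.elim (fun k ↦ if k % 2 = 0 then 3 * (k / 2) else -(3 * (k / 2) + 1)) (fun l ↦ 1 - 3 * l)
  have hf : Function.Bijective f := by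
    constructor
    · rintro (a | a) (b | b) h <;> simp only [f, Sum.elim_inl, Sum.elim_inr] at h <;>
        simp only [Sum.inl.injEq, Sum.inr.injEq, reduceCtorEq] <;> grind
    · intro m
      rcases (by lia : m % 3 = 0 ∨ m % 3 = 1 ∨ m % 3 = 2) with h | h | h
      · exact ⟨.inl (2 * (m / 3)), by simp only [f, Sum.elim_inl]; split_ifs <;> lia⟩
      · exact ⟨.inr (-(m / 3)), by simp only [f, Sum.elim_inr]; lia⟩
      · exact ⟨.inl (-2 * (m / 3) - 1), by simp only [f, Sum.elim_inl]; split_ifs <;> lia⟩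
  rw [← countSeries_add_one, ← countSeries_sumElim _ _ (finite_thetaExp_fiber (by lia) (by lia)),
    ← countSeries_comp_equiv _ (Equiv.ofBijective f hf)]
  · congr 1
    ext (k | l)
    · have h₁ := two_mul_thetaExp 3 6 k
      have h₂ := two_mul_thetaExp 1 3 (f (.inl k))
      simp only [Function.comp, Equiv.ofBijective_apply, Sum.elim_inl]
      zify
      suffices h : 2 * (thetaExp 1 3 (f (.inl k)) : ℤ) = 2 * thetaExp 3 6 k by lia
      rw [h₁, h₂]
      simp only [f, Sum.elim_inl]
      push_cast
      split_ifs with h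
      · obtain ⟨i, rfl⟩ : ∃ i, k = 2 * i := ⟨k / 2, by lia⟩
        rw [show 2 * i / 2 = i by lia]; ring
      · obtain ⟨i, rfl⟩ : ∃ i, k = 2 * i + 1 := ⟨k / 2, by lia⟩
        rw [show (2 * i + 1) / 2 = i by lia]; ring
    · have h₁ := two_mul_thetaExp 9 27 l
      have h₂ := two_mul_thetaExp 1 3 (1 - 3 * l)
      simp only [Function.comp, Equiv.ofBijective_apply, Sum.elim_inr, f]
      zify
      suffices h : 2 * (thetaExp 1 3 (1 - 3 * l) : ℤ) = 2 * (thetaExp 9 27 l + 1) by lia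
      rw [mul_add, h₁, h₂]
      push_cast
      ring
  · intro n
    cases n with
    | zero => simp only [Nat.add_eq_zero_iff, one_ne_zero, and_false]; infer_instance
    | succ n => simpa using finite_thetaExp_fiber (by lia) (by lia) n

/-- The even part of `ψ(q) ψ(q³)` is `φ(q⁶) ψ(q⁴)`. -/
theorem coeff_two_mul_thetaExp_mul (R : Type*) [Semiring R] (n : ℕ) :
    coeff (2 * n) (countSeries R (thetaExp 1 3) * countSeries R (thetaExp 3 9)) =
      coeff n (countSeries R (thetaExp 3 3) * countSeries R (thetaExp 2 6)) := by
  rw [countSeries_mul _ _ (finite_thetaExp_fiber (by lia) (by lia))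
      (finite_thetaExp_fiber (by lia) (by lia)),
    countSeries_mul _ _ (finite_thetaExp_fiber (by lia) (by lia))
      (finite_thetaExp_fiber (by lia) (by lia))]
  simp only [countSeries, coeff_mk]
  congr 1
  let σ : ℤ × ℤ → ℤ × ℤ := fun p ↦ if p.1 % 2 = 0 then (p.2 + 3 * (p.1 / 2), p.2 - p.1 / 2)
    else (3 * (p.1 / 2) + 2 - p.2, -(p.1 / 2) - p.2)
  have hσ (p : ℤ × ℤ) : thetaExp 1 3 (σ p).1 + thetaExp 3 9 (σ p).2 =
      2 * (thetaExp 3 3 p.1 + thetaExp 2 6 p.2) := by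
    obtain ⟨k, l⟩ := p
    have h₁ := two_mul_thetaExp 1 3 (σ (k, l)).1
    have h₂ := two_mul_thetaExp 3 9 (σ (k, l)).2
    have h₃ := two_mul_thetaExp 3 3 k
    have h₄ := two_mul_thetaExp 2 6 l
    zify
    suffices h : 2 * (thetaExp 1 3 (σ (k, l)).1 : ℤ) + 2 * thetaExp 3 9 (σ (k, l)).2 =
      2 * (2 * thetaExp 3 3 k + 2 * thetaExp 2 6 l) by lia
    rw [h₁, h₂, h₃, h₄]
    push_cast
    rcases Int.even_or_odd' k with ⟨i, rfl | rfl⟩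
    · rw [show σ (2 * i, l) = (l + 3 * i, l - i) by
        simp only [σ]; rw [if_pos (by lia), show 2 * i / 2 = i by lia]]
      ring
    · rw [show σ (2 * i + 1, l) = (3 * i + 2 - l, -i - l) by
        simp only [σ]; rw [if_neg (by lia), show (2 * i + 1) / 2 = i by lia]]
      ring
  refine (Nat.card_congr (Equiv.ofBijective
    (fun p : {p : ℤ × ℤ // thetaExp 3 3 p.1 + thetaExp 2 6 p.2 = n} ↦
      (⟨σ p.1, by rw [hσ, p.2]⟩ :
        {p : ℤ × ℤ // thetaExp 1 3 p.1 + thetaExp 3 9 p.2 = 2 * n})) ⟨?_, ?_⟩)).symm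
  · rintro ⟨⟨a, b⟩, _⟩ ⟨⟨c, d⟩, _⟩ h
    simp only [Subtype.mk.injEq, σ] at h
    simp only [Subtype.mk.injEq, Prod.mk.injEq]
    split_ifs at h <;> simp only [Prod.mk.injEq] at h <;> lia
  · rintro ⟨⟨m, j⟩, h⟩
    have h₁ := two_mul_thetaExp 1 3 m
    have h₂ := two_mul_thetaExp 3 9 j
    have hpar : (m - j) % 2 = 0 := by
      simp only at h
      have h₃ : 2 * m * m - m + 6 * j * j - 3 * j = 2 * n := by
        zify at h
        push_cast at h₁ h₂
        linarith
      have h₄ : m - j = 2 * (m * m + 3 * (j * j) - 2 * j - n) := by linarith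
      lia
    have hex : ∃ p, σ p = (m, j) := by
      by_cases hk : (m - j) / 2 % 2 = 0
      · refine ⟨((m - j) / 2, j + (m - j) / 2 / 2), ?_⟩
        simp only [σ, if_pos hk, Prod.mk.injEq]
        lia
      · refine ⟨((m - j) / 2, -j - (m - j) / 2 / 2), ?_⟩
        simp only [σ, if_neg hk, Prod.mk.injEq]
        lia
    obtain ⟨p, hp⟩ := hex
    have hn := hσ p
    rw [hp] at hn
    simp only at h
    exact ⟨⟨p, by lia⟩, Subtype.ext hp⟩

/-- The squares of the positive integers prime to `3`. -/
def squareExp (k : {k : ℕ // 1 ≤ k ∧ ¬ 3 ∣ k}) : ℕ := k.1 ^ 2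

theorem finite_squareExp_fiber (n : ℕ) : Finite {k // squareExp k = n} := by
  refine Finite.of_injective (β := Fin (n + 1))
    (fun k ↦ ⟨k.1.1, by have := k.2; unfold squareExp at this; nlinarith [k.1.2.1]⟩) ?_
  rintro ⟨⟨k, _⟩, _⟩ ⟨⟨l, _⟩, _⟩ h
  simpa using h

theorem countSeries_squareExp (R : Type*) [Semiring R] :
    countSeries R squareExp = X * countSeries R (thetaExp 3 15) := by
  let f : ℤ → {k : ℕ // 1 ≤ k ∧ ¬ 3 ∣ k} := fun k ↦ ⟨(3 * k - 1).natAbs, by lia, by lia⟩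
  have hf : Function.Bijective f := by
    constructor
    · intro a b h
      simp only [f, Subtype.mk.injEq] at h
      lia
    · rintro ⟨m, h₁, h₂⟩
      rcases (by lia : m % 3 = 1 ∨ m % 3 = 2) with h | h
      · exact ⟨-(m / 3 : ℕ), Subtype.ext (by simp only [f]; lia)⟩
      · exact ⟨m / 3 + 1, Subtype.ext (by simp only [f]; lia)⟩
  rw [← countSeries_add_one, ← countSeries_comp_equiv _ (Equiv.ofBijective f hf)]
  congr 1
  ext k
  have h := two_mul_thetaExp 3 15 k
  simp only [Function.comp, Equiv.ofBijective_apply, f, squareExp]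
  zify
  rw [sq_abs]
  push_cast at h
  linarith

section GenFun

variable {R : Type*} [CommRing R]

/-- The generating function of `PD 2`. -/
noncomputable def genPD (R : Type*) [CommRing R] : R⟦X⟧ := PowerSeries.mk fun n ↦ (PD 2 n : R)

theorem genPD_eq_genFun :
    genPD R = Nat.Partition.genFun fun i c ↦ if 2 ∣ i then (0 : R) else c := by
  ext n
  rw [genPD, coeff_mk, Nat.Partition.coeff_genFun, PD, Nat.cast_sum]
  refine sum_congr rfl fun p _ ↦ ?_
  rw [Finsupp.prod, Multiset.toFinsupp_support]
  simp only [Multiset.toFinsupp_apply]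
  split_ifs with h
  · rw [Nat.cast_prod]
    exact prod_congr rfl fun s hs ↦ (if_neg (h s (Multiset.mem_toFinset.mp hs))).symm
  · push Not at h
    obtain ⟨s, hs, hd⟩ := h
    rw [Nat.cast_zero, eq_comm]
    refine prod_eq_zero (Multiset.mem_toFinset.mpr hs) ?_
    exact if_pos hd

variable [TopologicalSpace R] [DiscreteTopology R]

theorem one_add_tsum_mul {s : ℕ} (hs : s ≠ 0) :
    (1 + ∑' j : ℕ, ((j + 1 : ℕ) : R) • (X : R⟦X⟧) ^ (s * (j + 1))) *
      ((1 + X ^ s) * (1 - X ^ s) ^ 2) = 1 + X ^ (3 * s) := by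
  have h0 : constantCoeff ((X : R⟦X⟧) ^ s) = 0 := by simp [hs]
  have hgeo := WithPiTopology.tsum_pow_mul_one_sub_of_constantCoeff_eq_zero h0
  have hsum₁ := WithPiTopology.summable_pow_of_constantCoeff_eq_zero h0
  have hsum₂ := Nat.Partition.summable_genFun_term' (fun _ c ↦ (c : R)) hs
  have hshift := hsum₂.tsum_eq_zero_add
  have hrec (j : ℕ) : ((j + 1 + 1 : ℕ) : R) • (X : R⟦X⟧) ^ (s * (j + 1 + 1)) =
      X ^ s * (((j + 1 : ℕ) : R) • (X : R⟦X⟧) ^ (s * (j + 1))) + X ^ s * X ^ s * (X ^ s) ^ j := by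
    rw [Nat.cast_succ (j + 1), add_smul, one_smul, mul_smul_comm, ← pow_add, ← pow_mul, ← pow_add,
      ← pow_add]
    ring_nf
  simp only [hrec] at hshift
  rw [(hsum₂.mul_left _).tsum_add (hsum₁.mul_left _), hsum₂.tsum_mul_left,
    hsum₁.tsum_mul_left] at hshift
  simp only [zero_add, mul_one, Nat.cast_one, one_smul] at hshift
  have h3 : (X : R⟦X⟧) ^ (3 * s) = (X ^ s) ^ 3 := by rw [← pow_mul, mul_comm]
  rw [h3]
  linear_combination (1 - (X : R⟦X⟧) ^ s) * (1 + X ^ s) * hshift +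
    (X ^ s) ^ 2 * (1 + (X : R⟦X⟧) ^ s) * hgeo

theorem genPD_mul :
    genPD R * (prodSeries 1 1 2 * prodSeries (-1) 1 2 ^ 2) = prodSeries 1 3 6 := by
  have hG := (Nat.Partition.hasProd_genFun
    fun i c ↦ if 2 ∣ i then (0 : R) else c).tendsto_prod_nat.comp
      (Filter.tendsto_id.const_mul_atTop' (two_pos))
  rw [← genPD_eq_genFun] at hG
  refine tendsto_nhds_unique (hG.mul ((tendsto_prodSeries 1 1 two_pos).mul
    ((tendsto_prodSeries (-1) 1 two_pos).pow 2)))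
    ((tendsto_prodSeries 1 3 (b := 6) (by lia)).congr fun n ↦ ?_)
  simp only [Function.comp, id]
  induction n with
  | zero => simp
  | succ n ih =>
    have hodd : ¬ 2 ∣ 2 * n + 1 := by lia
    have heven : 2 ∣ 2 * n + 1 + 1 := by lia
    have hfac := one_add_tsum_mul (R := R) (s := 2 * n + 1) (by lia)
    rw [prod_range_succ, prod_range_succ (fun i ↦ 1 + C 1 * X ^ (1 + 2 * i)),
      prod_range_succ (fun i ↦ 1 + C (-1) * X ^ (1 + 2 * i)),
      show 2 * (n + 1) = 2 * n + 1 + 1 by ring, prod_range_succ, prod_range_succ, ih]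
    simp only [hodd, heven, if_true, if_false, zero_smul, tsum_zero, add_zero, mul_one, map_neg,
      map_one, one_mul]
    rw [show 3 + 6 * n = 3 * (2 * n + 1) by ring, ← hfac, add_comm 1 (2 * n)]
    ring

end GenFun

theorem coeff_two_mul_mul_expand {R : Type*} [CommRing R] (f g : R⟦X⟧) (n : ℕ) :
    coeff (2 * n) (f * PowerSeries.expand 2 two_ne_zero g) =
      coeff n (PowerSeries.mk (fun m ↦ coeff (2 * m) f) * g) := by
  have hf : f = PowerSeries.expand 2 two_ne_zero (PowerSeries.mk fun m ↦ coeff (2 * m) f) +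
      X * PowerSeries.expand 2 two_ne_zero (PowerSeries.mk fun m ↦ coeff (2 * m + 1) f) := by
    ext m
    rcases Nat.even_or_odd' m with ⟨k, rfl | rfl⟩
    · cases k with
      | zero => simp
      | succ k =>
        rw [map_add, show 2 * (k + 1) = 2 * k + 1 + 1 by ring, coeff_succ_X_mul,
          PowerSeries.coeff_expand, PowerSeries.coeff_expand, if_pos (by lia), if_neg (by lia),
          coeff_mk, add_zero]
        congr 2
        lia
    · rw [map_add, coeff_succ_X_mul, PowerSeries.coeff_expand, PowerSeries.coeff_expand,
        if_neg (by lia), if_pos (by lia), coeff_mk, zero_add]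
      congr 2
      lia
  conv_lhs => rw [hf, add_mul, mul_assoc, ← map_mul, ← map_mul, map_add]
  rw [PowerSeries.coeff_expand_mul]
  cases n with
  | zero => simp
  | succ n =>
    rw [show 2 * (n + 1) = 2 * n + 1 + 1 by ring, coeff_succ_X_mul,
      PowerSeries.coeff_expand_of_not_dvd _ _ _ (by lia), add_zero]

theorem mk_PD_two_mul_eq_sq : PowerSeries.mk (fun n ↦ (PD 2 (2 * n) : ℤ)) = genPD ℤ ^ 2 := by
  have hG := genPD_mul (R := ℤ)
  have hM₁ := prodSeries_one_mul_neg_one (R := ℤ) 1 two_pos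
  have hM₂ := prodSeries_one_mul_neg_one (R := ℤ) 2 (b := 4) (by lia)
  have hN₁ := prodSeries_eq_mul (1 : ℤ) 1 two_pos
  have hN₂ := prodSeries_eq_mul (1 : ℤ) 2 (b := 4) (by lia)
  have hN₃ := prodSeries_eq_mul (1 : ℤ) 3 (b := 6) (by lia)
  have hM₃ := prodSeries_eq_mul (-1 : ℤ) 2 two_pos
  have hM₄ := prodSeries_eq_mul (-1 : ℤ) 4 (b := 4) (by lia)
  have hψ₁ := countSeries_thetaExp (R := ℤ) (u := 1) (v := 3) (by lia) (by lia)
  have hψ₃ := countSeries_thetaExp (R := ℤ) (u := 3) (v := 9) (by lia) (by lia)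
  have hφ₃ := countSeries_thetaExp (R := ℤ) (u := 3) (v := 3) (by lia) (by lia)
  have hψ₂ := countSeries_thetaExp (R := ℤ) (u := 2) (v := 6) (by lia) (by lia)
  norm_num only at hM₁ hM₂ hN₁ hN₂ hN₃ hM₃ hM₄ hψ₁ hψ₃ hφ₃ hψ₂
  set D : ℤ⟦X⟧ := prodSeries (-1) 1 2 ^ 2 * prodSeries (-1) 2 2 * prodSeries (-1) 6 6 with hD
  have hD₀ : D ≠ 0 := by
    have h {a b : ℕ} := prodSeries_ne_zero (R := ℤ) (-1) (a := a) (b := b)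
    exact mul_ne_zero (mul_ne_zero (pow_ne_zero _ (h (by lia) (by lia))) (h (by lia) (by lia)))
      (h (by lia) (by lia))
  have hGD : genPD ℤ * PowerSeries.expand 2 two_ne_zero D =
      countSeries ℤ (thetaExp 1 3) * countSeries ℤ (thetaExp 3 9) := by
    rw [hD, map_mul, map_mul, map_pow, expand_prodSeries _ _ _ (by lia),
      expand_prodSeries _ _ _ (by lia), expand_prodSeries _ _ _ (by lia)]
    norm_num only
    rw [hψ₁, hψ₃, ← hN₁, ← hN₃, ← hM₁, ← hG]
    ring
  apply mul_right_cancel₀ hD₀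
  trans countSeries ℤ (thetaExp 3 3) * countSeries ℤ (thetaExp 2 6)
  · ext n
    rw [← coeff_two_mul_thetaExp_mul, ← hGD, coeff_two_mul_mul_expand]
    simp [genPD]
  · rw [hφ₃, hψ₂, ← hN₂, hD, hM₃, hM₄, ← hM₂, ← hM₁, ← hG]
    ring

theorem genPD_zmod_two : genPD (ZMod 2) = 1 + countSeries (ZMod 2) squareExp := by
  have hneg : (-1 : ZMod 2) = 1 := by decide
  have hG := genPD_mul (R := ZMod 2)
  have hsq (a : ℕ) {b : ℕ} (hb : 0 < b) :
      prodSeries (1 : ZMod 2) (2 * a) (2 * b) = prodSeries 1 a b ^ 2 := by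
    have := prodSeries_one_mul_neg_one (R := ZMod 2) a hb
    rw [hneg] at this
    rw [← this, sq]
  have hinv {a : ℕ} (ha : 0 < a) :
      prodSeries (1 : ZMod 2) a (2 * a) * prodSeries 1 a a = 1 := by
    have h := prodSeries_eq_mul (1 : ZMod 2) a ha
    rw [← two_mul, hsq a ha] at h
    apply mul_right_cancel₀ (prodSeries_ne_zero (1 : ZMod 2) ha ha)
    linear_combination -h
  have hθ {u v : ℕ} (hu : 0 < u) (hv : 0 < v) := countSeries_thetaExp (R := ZMod 2) hu hv
  simp only [hneg] at hG hθ
  have hψ := hθ (u := 1) (v := 3) (by lia) (by lia)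
  have hψ₉ := hθ (u := 9) (v := 27) (by lia) (by lia)
  have hA := hθ (u := 3) (v := 6) (by lia) (by lia)
  have hT := hθ (u := 3) (v := 15) (by lia) (by lia)
  have h₁ := hinv one_pos
  have h₃ := hinv three_pos
  have s₁ := prodSeries_eq_mul (1 : ZMod 2) 1 two_pos
  have s₂ := prodSeries_eq_mul (1 : ZMod 2) 9 (b := 18) (by lia)
  have s₃ := prodSeries_eq_mul (1 : ZMod 2) 18 (b := 18) (by lia)
  have s₄ := prodSeries_eq_mul_mul (1 : ZMod 2) 3 (b := 3) (by lia)
  have s₅ := prodSeries_eq_mul_mul (1 : ZMod 2) 3 (b := 6) (by lia)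
  have q₁ := hsq 1 one_pos
  have q₂ := hsq 2 two_pos
  have q₃ := hsq 9 (b := 18) (by lia)
  norm_num only at hψ hψ₉ hA hT h₁ h₃ s₁ s₂ s₃ s₄ s₅ q₁ q₂ q₃
  have hψ₉' : countSeries (ZMod 2) (thetaExp 9 27) =
      prodSeries 1 3 3 * countSeries (ZMod 2) (thetaExp 3 15) := by
    apply mul_left_cancel₀ (prodSeries_ne_zero (1 : ZMod 2) (a := 9) (b := 18) (by lia) (by lia))
    rw [hψ₉, ← s₂, hT]
    rw [s₅] at h₃
    rw [q₃] at s₃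
    linear_combination -s₃ - prodSeries 1 18 18 * h₃
  have hGψ : genPD (ZMod 2) * prodSeries 1 3 3 = countSeries (ZMod 2) (thetaExp 1 3) := by
    rw [hψ, ← s₁, q₂, q₁]
    set p := prodSeries (1 : ZMod 2) 1 2
    set r := prodSeries (1 : ZMod 2) 1 1
    have hp : genPD (ZMod 2) * prodSeries 1 3 3 * p ^ 3 = 1 := by
      rw [← h₃, ← hG]; ring
    calc _ = genPD (ZMod 2) * prodSeries 1 3 3 * (p * r) ^ 3 := by rw [h₁]; ring
      _ = genPD (ZMod 2) * prodSeries 1 3 3 * p ^ 3 * r ^ 3 := by ring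
      _ = p * r * r ^ 3 := by rw [hp, h₁]
      _ = _ := by ring
  apply mul_right_cancel₀ (prodSeries_ne_zero (1 : ZMod 2) three_pos three_pos)
  rw [hGψ, countSeries_thetaExp_one_three, hψ₉', hA, countSeries_squareExp, ← s₄]
  ring

theorem stmt_11 (n : ℕ) :
    PD 2 (2 * n) ≡
      (if n = 0 then 1 else 0) +
      2 * Nat.card {k : ℕ // 1 ≤ k ∧ ¬ 3 ∣ k ∧ n = k ^ 2} +
      Nat.card {p : ℕ × ℕ //
        1 ≤ p.1 ∧ 1 ≤ p.2 ∧ ¬ 3 ∣ p.1 ∧ ¬ 3 ∣ p.2 ∧ n = p.1 ^ 2 + p.2 ^ 2} [MOD 4] := by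
  set T := countSeries ℤ squareExp with hT
  have hdvd (m : ℕ) : ∃ c, coeff m (genPD ℤ) - coeff m (1 + T) = 2 * c := by
    have h := congrArg (coeff m) genPD_zmod_two
    refine (ZMod.intCast_eq_intCast_iff_dvd_sub _ _ 2).mp ?_
    simp only [genPD, map_add, coeff_mk, countSeries, coeff_one, T] at h ⊢
    push_cast
    exact h.symm
  choose c hc using hdvd
  have hG : genPD ℤ = 1 + T + 2 * PowerSeries.mk c := by
    ext m
    rw [two_mul, map_add, map_add _ (PowerSeries.mk c), coeff_mk]
    linarith [hc m]
  have hsq : PowerSeries.mk (fun n ↦ (PD 2 (2 * n) : ℤ)) = 1 + (T + T) + T * T +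
      C 4 * ((1 + T) * PowerSeries.mk c + PowerSeries.mk c ^ 2) := by
    rw [mk_PD_two_mul_eq_sq, hG, show (C 4 : ℤ⟦X⟧) = 4 from map_ofNat _ 4]
    ring
  have hA : Nat.card {k : ℕ // 1 ≤ k ∧ ¬ 3 ∣ k ∧ n = k ^ 2} =
      Nat.card {k // squareExp k = n} := Nat.card_congr
    { toFun k := ⟨⟨k.1, k.2.1, k.2.2.1⟩, k.2.2.2.symm⟩
      invFun k := ⟨k.1.1, k.1.2.1, k.1.2.2, k.2.symm⟩
      left_inv _ := rfl
      right_inv _ := rfl }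
  have hB : Nat.card {p : ℕ × ℕ //
        1 ≤ p.1 ∧ 1 ≤ p.2 ∧ ¬ 3 ∣ p.1 ∧ ¬ 3 ∣ p.2 ∧ n = p.1 ^ 2 + p.2 ^ 2} =
      Nat.card {p : {k : ℕ // 1 ≤ k ∧ ¬ 3 ∣ k} × {k : ℕ // 1 ≤ k ∧ ¬ 3 ∣ k} //
        squareExp p.1 + squareExp p.2 = n} := Nat.card_congr
    { toFun p := ⟨(⟨p.1.1, p.2.1, p.2.2.2.1⟩, ⟨p.1.2, p.2.2.1, p.2.2.2.2.1⟩),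
        p.2.2.2.2.2.symm⟩
      invFun p := ⟨(p.1.1.1, p.1.2.1), p.1.1.2.1, p.1.2.2.1, p.1.1.2.2, p.1.2.2.2, p.2.symm⟩
      left_inv _ := rfl
      right_inv _ := rfl }
  have hcoeff := congrArg (coeff n) hsq
  rw [hT, countSeries_mul _ _ finite_squareExp_fiber finite_squareExp_fiber, ← hT] at hcoeff
  rw [map_add, coeff_C_mul, coeff_mk, map_add, map_add, map_add, coeff_one] at hcoeff
  rw [hA, hB, ← Int.natCast_modEq_iff, Int.modEq_comm, Int.modEq_iff_dvd, hcoeff]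
  refine ⟨coeff n ((1 + T) * PowerSeries.mk c + PowerSeries.mk c ^ 2), ?_⟩
  simp only [hT, countSeries, coeff_mk]
  push_cast
  ring
end

section
/- For all integers n ≥ 1, PD_2(n) ≡ N_n (mod 4), where N_n denotes the number of ordered pairs (k, m) with k an integer satisfying k ≥ 1 and 3 ∤ k, m an arbitrary integer (of either sign), and n = k² + m². -/
namespace DesignatedSummands

open PowerSeries Finset

variable {R : Type*} [CommRing R]

/-- The finite product `(1 - X ^ 2) (1 - X ^ 4) ⋯ (1 - X ^ (2 * j))`. -/
noncomputable def evenProd (R : Type*) [CommRing R] (j : ℕ) : R⟦X⟧ :=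
  ∏ i ∈ range j, (1 - X ^ (2 * i + 2))

lemma evenProd_succ (j : ℕ) :
    evenProd R (j + 1) = evenProd R j * (1 - X ^ (2 * j + 2)) :=
  prod_range_succ _ _

/-- The inverse of `evenProd`. -/
noncomputable def evenProdInv (R : Type*) [CommRing R] (j : ℕ) : R⟦X⟧ :=
  invOfUnit (evenProd R j) 1

lemma evenProd_mul_evenProdInv (j : ℕ) : evenProd R j * evenProdInv R j = 1 :=
  mul_invOfUnit _ _ (by simp [evenProd, map_prod])

/-- The extension of `evenProdInv` by zero to negative indices. -/
noncomputable def evenProdInvInt (R : Type*) [CommRing R] : ℤ → R⟦X⟧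
  | Int.ofNat j => evenProdInv R j
  | Int.negSucc _ => 0

lemma evenProdInvInt_natCast (j : ℕ) : evenProdInvInt R j = evenProdInv R j := rfl

lemma evenProdInvInt_of_neg {k : ℤ} (hk : k < 0) : evenProdInvInt R k = 0 := by
  obtain ⟨j, rfl⟩ := Int.eq_negSucc_of_lt_zero hk
  rfl

lemma evenProdInvInt_sub_one (j : ℕ) :
    evenProdInvInt R (j - 1) = (1 - X ^ (2 * j)) * evenProdInvInt R j := by
  cases j with
  | zero => simp [evenProdInvInt_of_neg]
  | succ j =>
    have h₁ := evenProd_mul_evenProdInv (R := R) j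
    have h₂ := evenProd_mul_evenProdInv (R := R) (j + 1)
    rw [evenProd_succ] at h₂
    rw [show ((j + 1 : ℕ) : ℤ) - 1 = j by push_cast; ring, evenProdInvInt_natCast,
      evenProdInvInt_natCast, mul_add_one]
    linear_combination evenProdInv R (j + 1) * (1 - X ^ (2 * j + 2)) * h₁ -
      evenProdInv R j * h₂

/-- The coefficient of `z ^ m` in `∏ j < n, (1 + z X ^ (2 * j + 1)) (1 + z⁻¹ X ^ (2 * j + 1))`. -/
noncomputable def tripleCoeff (R : Type*) [CommRing R] (n : ℕ) (m : ℤ) : R⟦X⟧ :=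
  X ^ (m.natAbs ^ 2) * evenProd R (2 * n) * evenProdInvInt R (n - m) * evenProdInvInt R (n + m)

lemma tripleCoeff_neg (n : ℕ) (m : ℤ) : tripleCoeff R n (-m) = tripleCoeff R n m := by
  simp only [tripleCoeff, Int.natAbs_neg, sub_neg_eq_add, ← sub_eq_add_neg]
  ring

lemma tripleCoeff_eq_zero {n : ℕ} {m : ℤ} (h : n < m.natAbs) : tripleCoeff R n m = 0 := by
  rcases le_total 0 m with hm | hm
  · rw [tripleCoeff, evenProdInvInt_of_neg (k := n - m) (by omega)]
    simp
  · rw [tripleCoeff, evenProdInvInt_of_neg (k := n + m) (by omega)]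
    simp

lemma tripleCoeff_succ_natCast (n m : ℕ) :
    tripleCoeff R (n + 1) m = (1 + X ^ (4 * n + 2)) * tripleCoeff R n m +
      X ^ (2 * n + 1) * (tripleCoeff R n (m - 1) + tripleCoeff R n (m + 1)) := by
  rcases lt_trichotomy m (n + 1) with hm | rfl | hm
  · obtain ⟨r, rfl⟩ := Nat.exists_eq_add_of_le (Nat.lt_succ_iff.mp hm)
    have e₁ := evenProdInvInt_sub_one (R := R) (r + 1)
    have e₂ := evenProdInvInt_sub_one (R := R) r
    have e₃ := evenProdInvInt_sub_one (R := R) (2 * m + r + 1)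
    have e₄ := evenProdInvInt_sub_one (R := R) (2 * m + r)
    push_cast at e₁ e₂ e₃ e₄
    rw [add_sub_cancel_right] at e₁ e₃
    have x₁ : (X : R⟦X⟧) ^ (2 * (m + r) + 1) * X ^ (((m : ℤ) - 1).natAbs ^ 2) =
        X ^ (m ^ 2) * X ^ (2 * (r + 1)) := by
      rw [← pow_add, ← pow_add]
      congr 1
      zify
      rw [sq_abs]
      ring
    have x₂ : (X : R⟦X⟧) ^ (2 * (m + r) + 1) * X ^ (((m : ℤ) + 1).natAbs ^ 2) =
        X ^ (m ^ 2) * X ^ (2 * (2 * m + r + 1)) := by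
      rw [← pow_add, ← pow_add]
      congr 1
      zify
      rw [sq_abs]
      ring
    simp only [tripleCoeff, Int.natAbs_natCast]
    push_cast
    rw [show (m + r + 1 - m : ℤ) = r + 1 by ring, show (m + r - m : ℤ) = r by ring,
      show (m + r - (m - 1) : ℤ) = r + 1 by ring, show (m + r - (m + 1) : ℤ) = r - 1 by ring,
      show (m + r + 1 + m : ℤ) = 2 * m + r + 1 by ring, show (m + r + m : ℤ) = 2 * m + r by ring,
      show (m + r + (m - 1) : ℤ) = 2 * m + r - 1 by ring,
      show (m + r + (m + 1) : ℤ) = 2 * m + r + 1 by ring]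
    rw [show 2 * (m + r + 1) = 2 * (m + r) + 1 + 1 by ring, evenProd_succ, evenProd_succ,
      e₂, e₄, e₁, e₃]
    generalize evenProdInvInt R _ = A
    generalize evenProdInvInt R _ = B
    generalize evenProd R _ = P
    linear_combination
      - (P * A * (1 - X ^ (2 * (2 * m + r))) * (1 - X ^ (2 * (2 * m + r + 1))) * B) * x₁
      - (P * B * (1 - X ^ (2 * r)) * (1 - X ^ (2 * (r + 1))) * A) * x₂
  · rw [tripleCoeff_eq_zero (m := ((n + 1 : ℕ) : ℤ)) (n := n) (by omega),
      tripleCoeff_eq_zero (m := ((n + 1 : ℕ) : ℤ) + 1) (n := n) (by omega)]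
    have top (k : ℕ) : tripleCoeff R k k = X ^ (k ^ 2) := by
      have h₀ := evenProd_mul_evenProdInv (R := R) 0
      have h₁ := evenProd_mul_evenProdInv (R := R) (2 * k)
      rw [evenProd, prod_range_zero, one_mul] at h₀
      rw [tripleCoeff, sub_self, show (k + k : ℤ) = (2 * k : ℕ) by push_cast; ring,
        evenProdInvInt_natCast, ← Int.natCast_zero, evenProdInvInt_natCast, h₀, mul_one, mul_assoc,
        h₁, Int.natAbs_natCast, mul_one]
    rw [top, show ((n + 1 : ℕ) : ℤ) - 1 = n by push_cast; ring, top]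
    ring
  · rw [tripleCoeff_eq_zero (by omega), tripleCoeff_eq_zero (by omega),
      tripleCoeff_eq_zero (by omega), tripleCoeff_eq_zero (by omega)]
    simp

lemma tripleCoeff_succ (n : ℕ) (m : ℤ) :
    tripleCoeff R (n + 1) m = (1 + X ^ (4 * n + 2)) * tripleCoeff R n m +
      X ^ (2 * n + 1) * (tripleCoeff R n (m - 1) + tripleCoeff R n (m + 1)) := by
  obtain ⟨k, rfl | rfl⟩ := m.eq_nat_or_neg
  · exact tripleCoeff_succ_natCast n k
  · rw [tripleCoeff_neg, tripleCoeff_neg, ← neg_add', tripleCoeff_neg,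
      show (-k + 1 : ℤ) = -(k - 1) by ring, tripleCoeff_neg, tripleCoeff_succ_natCast]
    ring

/-- `∏ j < n, (1 + a X ^ (2 * j + 1) + X ^ (4 * j + 2))`. -/
noncomputable def oddProd (a : R) (n : ℕ) : R⟦X⟧ :=
  ∏ j ∈ range n, (1 + C a * X ^ (2 * j + 1) + X ^ (4 * j + 2))

lemma tripleCoeff_mul_hasFiniteSupport (n : ℕ) (f : ℤ → R⟦X⟧) :
    Function.HasFiniteSupport fun m ↦ tripleCoeff R n m * f m := by
  refine (Set.finite_Icc (-n : ℤ) n).subset fun m hm ↦ ?_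
  by_contra h
  exact hm (by
    simp only [Set.mem_Icc] at h
    simp only [tripleCoeff_eq_zero (R := R) (n := n) (m := m) (by omega), zero_mul])

lemma oddProd_mul (a : R) (c : ℤ → R) (hc : ∀ m, c (m - 1) + c (m + 1) = a * c m) (n : ℕ) :
    oddProd a n * C (c 0) = ∑ᶠ m, tripleCoeff R n m * C (c m) := by
  induction n with
  | zero =>
    rw [finsum_eq_single _ 0]
    · have h := evenProd_mul_evenProdInv (R := R) 0
      have h₁ : evenProdInvInt R 0 = evenProdInv R 0 := rfl
      rw [evenProd, prod_range_zero, one_mul] at h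
      simp [oddProd, tripleCoeff, h₁, h, evenProd]
    · intro m hm
      rw [tripleCoeff_eq_zero (by omega), zero_mul]
  | succ n ih =>
    have hs := tripleCoeff_mul_hasFiniteSupport (R := R) n
    have h₁ : ∑ᶠ m, tripleCoeff R n (m - 1) * C (c m) =
        ∑ᶠ m, tripleCoeff R n m * C (c (m + 1)) := by
      rw [← finsum_comp_equiv (Equiv.addRight (1 : ℤ))]
      simp
    have h₂ : ∑ᶠ m, tripleCoeff R n (m + 1) * C (c m) =
        ∑ᶠ m, tripleCoeff R n m * C (c (m - 1)) := by
      rw [← finsum_comp_equiv (Equiv.subRight (1 : ℤ))]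
      simp
    have f₁ : Function.HasFiniteSupport fun m ↦ tripleCoeff R n (m - 1) * C (c m) := by
      have := (hs fun m ↦ C (c (m + 1))).comp_of_injective (sub_left_injective (b := (1 : ℤ)))
      simpa [Function.comp_def] using this
    have f₂ : Function.HasFiniteSupport fun m ↦ tripleCoeff R n (m + 1) * C (c m) := by
      have := (hs fun m ↦ C (c (m - 1))).comp_of_injective (add_left_injective (1 : ℤ))
      simpa [Function.comp_def] using this
    have h₃ : ∑ᶠ m, tripleCoeff R n m * C (c (m - 1)) + ∑ᶠ m, tripleCoeff R n m * C (c (m + 1)) =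
        C a * ∑ᶠ m, tripleCoeff R n m * C (c m) := by
      rw [← finsum_add_distrib (hs _) (hs _), mul_finsum' _ _ (hs _)]
      refine finsum_congr fun m ↦ ?_
      rw [← mul_add, ← map_add, hc, map_mul]
      ring
    calc oddProd a (n + 1) * C (c 0)
        = (oddProd a n * C (c 0)) * (1 + C a * X ^ (2 * n + 1) + X ^ (4 * n + 2)) := by
          rw [oddProd, prod_range_succ, ← oddProd]
          ring
      _ = (1 + X ^ (4 * n + 2)) * ∑ᶠ m, tripleCoeff R n m * C (c m) +
          X ^ (2 * n + 1) * (∑ᶠ m, tripleCoeff R n (m - 1) * C (c m) +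
            ∑ᶠ m, tripleCoeff R n (m + 1) * C (c m)) := by
          rw [h₁, h₂, ih]
          linear_combination -X ^ (2 * n + 1) * h₃
      _ = _ := by
          have f₃ : Function.HasFiniteSupport fun m ↦
              tripleCoeff R n (m - 1) * C (c m) + tripleCoeff R n (m + 1) * C (c m) := f₁.add f₂
          rw [← finsum_add_distrib f₁ f₂, mul_finsum' _ _ (hs _), mul_finsum' _ _ f₃]
          refine (finsum_add_distrib ((hs fun m ↦ C (c m)).mul_right _) (f₃.mul_right _)).symm.trans
            (finsum_congr fun m ↦ ?_)
          rw [tripleCoeff_succ, Pi.mul_apply, Pi.mul_apply]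
          ring

/-- The theta series `∑ m : ℤ, c m * X ^ (m ^ 2)`. -/
noncomputable def theta (c : ℤ → R) : R⟦X⟧ :=
  PowerSeries.mk fun k ↦ ∑ m ∈ Icc (-k : ℤ) k with m.natAbs ^ 2 = k, c m

lemma X_pow_dvd_theta_sub (c : ℤ → R) {d n : ℕ} (hn : d ≤ n) :
    X ^ (d + 1) ∣ theta c - ∑ m ∈ Icc (-n : ℤ) n, X ^ (m.natAbs ^ 2) * C (c m) := by
  rw [X_pow_dvd_iff]
  intro k hk
  simp only [theta, map_sub, coeff_mk, map_sum, coeff_mul_C, coeff_X_pow, ite_mul, one_mul,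
    zero_mul, sub_eq_zero, sum_filter, eq_comm (a := k)]
  refine sum_subset (Icc_subset_Icc (by omega) (by omega)) fun m _ hm ↦ if_neg fun h ↦ hm ?_
  have := Nat.le_self_pow two_ne_zero m.natAbs
  rw [mem_Icc]
  omega

lemma theta_congr {c c' : ℤ → R} (h₀ : c 0 = c' 0)
    (h : ∀ m, 0 < m → c m + c (-m) = c' m + c' (-m)) : theta c = theta c' := by
  ext k
  rw [theta, theta, coeff_mk, coeff_mk, ← sub_eq_zero, ← sum_sub_distrib]
  refine sum_involution (fun m _ ↦ -m) (fun m _ ↦ ?_) (fun m _ hm h' ↦ hm ?_) (fun m hm ↦ ?_)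
    (fun m _ ↦ neg_neg m)
  · rcases lt_trichotomy m 0 with hm | rfl | hm
    · have := h (-m) (by omega)
      rw [neg_neg] at this
      linear_combination this
    · simp [h₀]
    · linear_combination h m hm
  · obtain rfl : m = 0 := by omega
    rw [h₀, sub_self]
  · simp only [mem_filter, mem_Icc, Int.natAbs_neg] at hm ⊢
    omega

lemma theta_add (c c' : ℤ → R) : theta (fun m ↦ c m + c' m) = theta c + theta c' := by
  ext k
  simp [theta, sum_add_distrib]

lemma theta_ite_eq_zero : theta (fun m ↦ if m = 0 then (1 : R) else 0) = 1 := by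
  ext k
  rw [theta, coeff_mk, coeff_one, sum_filter]
  split_ifs with hk
  · simp [hk]
  · refine sum_eq_zero fun m _ ↦ ?_
    split_ifs with h₁ h₂
    · simp_all
    · rfl
    · rfl

lemma mk_evenProd_eq {I : Ideal R⟦X⟧} {d j : ℕ} (hI : X ^ (d + 1) ∈ I) (hj : d ≤ j) :
    Ideal.Quotient.mk I (evenProd R j) = Ideal.Quotient.mk I (evenProd R d) := by
  induction j, hj using Nat.le_induction with
  | base => rfl
  | succ j hj ih =>
    have : Ideal.Quotient.mk I (X ^ (2 * j + 2)) = 0 :=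
      Ideal.Quotient.eq_zero_iff_mem.mpr (I.mem_of_dvd (pow_dvd_pow X (by omega)) hI)
    rw [evenProd_succ, map_mul, map_sub, this, ih]
    simp

lemma mk_evenProdInv_eq {I : Ideal R⟦X⟧} {d j : ℕ} (hI : X ^ (d + 1) ∈ I) (hj : d ≤ j) :
    Ideal.Quotient.mk I (evenProdInv R j) = Ideal.Quotient.mk I (evenProdInv R d) := by
  have h₁ := congr_arg (Ideal.Quotient.mk I) (evenProd_mul_evenProdInv (R := R) j)
  have h₂ := congr_arg (Ideal.Quotient.mk I) (evenProd_mul_evenProdInv (R := R) d)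
  rw [map_mul, map_one] at h₁ h₂
  rw [mk_evenProd_eq hI hj] at h₁
  linear_combination Ideal.Quotient.mk I (evenProdInv R d) * h₁ -
    Ideal.Quotient.mk I (evenProdInv R j) * h₂

lemma mk_tripleCoeff {I : Ideal R⟦X⟧} {d n : ℕ} (hI : X ^ (d + 1) ∈ I) (hn : 2 * d ≤ n) (m : ℤ) :
    Ideal.Quotient.mk I (tripleCoeff R n m) =
      Ideal.Quotient.mk I (X ^ (m.natAbs ^ 2) * evenProdInv R d) := by
  rcases lt_or_ge d m.natAbs with hm | hm
  · have : Ideal.Quotient.mk I (X ^ (m.natAbs ^ 2)) = 0 :=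
      Ideal.Quotient.eq_zero_iff_mem.mpr <| I.mem_of_dvd (pow_dvd_pow X <|
        (Nat.succ_le_of_lt hm).trans (Nat.le_self_pow two_ne_zero _)) hI
    simp only [tripleCoeff, map_mul, this, zero_mul]
  · obtain ⟨r, hr⟩ := Int.eq_ofNat_of_zero_le (a := n - m) (by omega)
    obtain ⟨s, hs⟩ := Int.eq_ofNat_of_zero_le (a := n + m) (by omega)
    rw [tripleCoeff, hr, hs, evenProdInvInt_natCast, evenProdInvInt_natCast]
    have h := congr_arg (Ideal.Quotient.mk I) (evenProd_mul_evenProdInv (R := R) d)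
    rw [map_mul, map_one] at h
    simp only [map_mul]
    rw [mk_evenProd_eq hI (show d ≤ 2 * n by omega), mk_evenProdInv_eq hI (show d ≤ r by omega),
      mk_evenProdInv_eq hI (show d ≤ s by omega)]
    linear_combination Ideal.Quotient.mk I (X ^ (m.natAbs ^ 2)) *
      Ideal.Quotient.mk I (evenProdInv R d) * h

lemma X_pow_dvd_oddProd_sub {a : R} {c : ℤ → R} (hc : ∀ m, c (m - 1) + c (m + 1) = a * c m)
    (h₀ : c 0 = 1) {d n : ℕ} (hn : 2 * d ≤ n) :
    X ^ (d + 1) ∣ oddProd a n - evenProdInv R d * theta c := by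
  have hI : (X : R⟦X⟧) ^ (d + 1) ∈ Ideal.span {X ^ (d + 1)} := Ideal.mem_span_singleton_self _
  have hθ := X_pow_dvd_theta_sub c (show d ≤ n by omega)
  have h := oddProd_mul a c hc n
  rw [h₀, map_one, mul_one, finsum_eq_sum_of_support_subset (s := Icc (-n : ℤ) n)] at h
  · rw [← Ideal.mem_span_singleton, ← Ideal.Quotient.eq] at hθ ⊢
    rw [h, map_mul, hθ, map_sum, map_sum, mul_sum]
    refine sum_congr rfl fun m _ ↦ ?_
    rw [map_mul, mk_tripleCoeff hI hn, map_mul, map_mul]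
    ring
  · intro m hm
    by_contra h'
    refine hm ?_
    simp only [coe_Icc, Set.mem_Icc] at h'
    simp only [tripleCoeff_eq_zero (R := R) (n := n) (m := m) (by omega), zero_mul]

open scoped PowerSeries.WithPiTopology in
lemma one_add_tsum_mul [TopologicalSpace R] [T2Space R] [IsTopologicalRing R] {s : ℕ}
    (hs : s ≠ 0) :
    (1 + ∑' j : ℕ, ((j + 1 : ℕ) : R) • (X : R⟦X⟧) ^ (s * (j + 1))) *
      (1 + C (-2) * X ^ s + X ^ (2 * s)) = 1 + C (-1) * X ^ s + X ^ (2 * s) := by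
  have hx : constantCoeff ((X : R⟦X⟧) ^ s) = 0 := by simp [hs]
  have hsum : Summable fun j : ℕ ↦ ((j + 1 : ℕ) : R) • (X : R⟦X⟧) ^ (s * (j + 1)) :=
    Nat.Partition.summable_genFun_term' (fun _ j ↦ (j : R)) hs
  have hgeo := WithPiTopology.summable_pow_of_constantCoeff_eq_zero hx
  have hg := WithPiTopology.tsum_pow_mul_one_sub_of_constantCoeff_eq_zero hx
  have key : ∑' j : ℕ, ((j + 1 : ℕ) : R) • (X : R⟦X⟧) ^ (s * (j + 1)) =
      X ^ s * ((∑' j : ℕ, ((j + 1 : ℕ) : R) • (X : R⟦X⟧) ^ (s * (j + 1))) +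
        ∑' j : ℕ, ((X : R⟦X⟧) ^ s) ^ j) := by
    have hgeo' := (summable_nat_add_iff 1).mpr hgeo
    rw [hgeo.tsum_eq_zero_add, pow_zero, add_left_comm, ← hsum.tsum_add hgeo', mul_one_add,
      ← (hsum.add hgeo').tsum_mul_left, hsum.tsum_eq_zero_add]
    congr 1
    · simp
    · refine tsum_congr fun j ↦ ?_
      rw [smul_eq_C_mul, smul_eq_C_mul, Nat.cast_add_one (j + 1), map_add, map_one]
      ring
  rw [map_neg, map_neg, map_one, map_ofNat]
  linear_combination (1 - X ^ s) * key + X ^ s * hg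

/-- The generating function of `PD 2`. -/
noncomputable def genPD (R : Type*) [CommRing R] : R⟦X⟧ := PowerSeries.mk fun n ↦ (PD 2 n : R)

open scoped PowerSeries.WithPiTopology in
lemma exists_X_pow_dvd_genPD (d : ℕ) :
    ∃ N, ∀ n ≥ N, X ^ (d + 1) ∣ genPD R * oddProd (-2) n - oddProd (-1) n := by
  let _ : TopologicalSpace R := ⊥
  have : DiscreteTopology R := ⟨rfl⟩
  let f : ℕ → ℕ → R := fun s c ↦ if 2 ∣ s then 0 else (c : R)
  have hf : Nat.Partition.genFun f = genPD R := by
    ext n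
    rw [Nat.Partition.coeff_genFun, genPD, coeff_mk, PD, Nat.cast_sum]
    refine sum_congr rfl fun p _ ↦ ?_
    rw [Finsupp.prod, Multiset.toFinsupp_support]
    split_ifs with h
    · rw [Nat.cast_prod]
      refine prod_congr rfl fun s hs ↦ ?_
      rw [Multiset.toFinsupp_apply]
      exact if_neg (h s (Multiset.mem_toFinset.mp hs))
    · push Not at h
      obtain ⟨s, hs, hs'⟩ := h
      rw [Nat.cast_zero]
      exact prod_eq_zero (Multiset.mem_toFinset.mpr hs) (if_pos hs')
  let F : ℕ → R⟦X⟧ := fun i ↦ 1 + ∑' j, f (i + 1) (j + 1) • X ^ ((i + 1) * (j + 1))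
  have hF : HasProd F (genPD R) := hf ▸ Nat.Partition.hasProd_genFun f
  have hprod (n : ℕ) : (∏ i ∈ range (2 * n), F i) * oddProd (-2) n = oddProd (-1) n := by
    induction n with
    | zero => simp [oddProd]
    | succ n ih =>
      have h₁ : F (2 * n + 1) = 1 := by
        have : 2 ∣ 2 * n + 1 + 1 := by omega
        simp [F, f, this]
      have h₂ : F (2 * n) * (1 + C (-2) * X ^ (2 * n + 1) + X ^ (4 * n + 2)) =
          1 + C (-1) * X ^ (2 * n + 1) + X ^ (4 * n + 2) := by
        have := one_add_tsum_mul (R := R) (s := 2 * n + 1) (by omega)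
        rw [show 2 * (2 * n + 1) = 4 * n + 2 by ring] at this
        rw [← this]
        have h₃ : ¬ 2 ∣ 2 * n + 1 := by omega
        simp [F, f, h₃]
      rw [show 2 * (n + 1) = 2 * n + 1 + 1 by ring, prod_range_succ, prod_range_succ, h₁, oddProd,
        oddProd, prod_range_succ, prod_range_succ, ← oddProd, ← oddProd, ← h₂, ← ih]
      ring
  have hlim := hF.tendsto_prod_nat
  rw [WithPiTopology.tendsto_iff_coeff_tendsto] at hlim
  have hev : ∀ᶠ n in Filter.atTop, ∀ k ∈ range (d + 1),
      coeff k (∏ i ∈ range n, F i) = coeff k (genPD R) := by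
    rw [Filter.eventually_all_finset]
    intro k _
    have := hlim k
    rwa [nhds_discrete, Filter.tendsto_pure] at this
  obtain ⟨N, hN⟩ := Filter.eventually_atTop.mp hev
  refine ⟨N, fun n hn ↦ ?_⟩
  rw [← hprod, ← sub_mul]
  refine Dvd.dvd.mul_right (X_pow_dvd_iff.mpr fun k hk ↦ ?_) _
  rw [map_sub, hN (2 * n) (by omega) k (mem_range.mpr hk), sub_self]

theorem genPD_mul_theta {c c' : ℤ → R} (hc : ∀ m, c (m - 1) + c (m + 1) = -2 * c m)
    (h₀ : c 0 = 1) (hc' : ∀ m, c' (m - 1) + c' (m + 1) = -1 * c' m) (h₀' : c' 0 = 1) :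
    genPD R * theta c = theta c' := by
  ext d
  obtain ⟨N, hN⟩ := exists_X_pow_dvd_genPD (R := R) d
  have h := hN (max N (2 * d)) (le_max_left _ _)
  have h₁ := X_pow_dvd_oddProd_sub hc h₀ (le_max_right N (2 * d))
  have h₂ := X_pow_dvd_oddProd_sub hc' h₀' (le_max_right N (2 * d))
  have h₃ : X ^ (d + 1) ∣ genPD R * theta c - theta c' := by
    have := ((h.sub (h₁.mul_left (genPD R))).add h₂).mul_left (evenProd R d)
    convert! this using 1
    linear_combination -(genPD R * theta c - theta c') * evenProd_mul_evenProdInv (R := R) d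
  have := X_pow_dvd_iff.mp h₃ d (Nat.lt_succ_self d)
  rwa [map_sub, sub_eq_zero] at this

/-- The theta series `∑ k, X ^ (k ^ 2)` over positive integers `k` not divisible by `3`. -/
noncomputable def thetaPos (R : Type*) [CommRing R] : R⟦X⟧ :=
  theta fun m ↦ if 0 < m ∧ ¬ 3 ∣ m then 1 else 0

lemma genPD_zmod_four : genPD (ZMod 4) = 1 + thetaPos (ZMod 4) * theta (fun _ ↦ 1) := by
  set t : (ZMod 4)⟦X⟧ := theta fun _ ↦ 1
  have four : (4 : (ZMod 4)⟦X⟧) = 0 := by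
    rw [← map_ofNat (C (R := ZMod 4)) 4]
    exact map_zero C
  have ht : t * t = 1 := by
    have : t = 1 + (theta (fun m ↦ if 0 < m then 1 else 0) +
        theta (fun m ↦ if 0 < m then 1 else 0)) := by
      rw [← theta_add, ← theta_ite_eq_zero, ← theta_add]
      refine theta_congr (by simp) fun m hm ↦ ?_
      simp [hm, hm.ne', hm.not_gt]
    rw [this]
    linear_combination (theta (fun m : ℤ ↦ if 0 < m then (1 : ZMod 4) else 0) +
      theta (fun m : ℤ ↦ if 0 < m then (1 : ZMod 4) else 0) ^ 2) * four
  have halt : theta (fun m : ℤ ↦ if Even m then (1 : ZMod 4) else -1) = t := by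
    refine theta_congr (by simp) fun m _ ↦ ?_
    simp only [even_neg]
    split_ifs <;> decide
  have hthree : theta (fun m : ℤ ↦ if m % 3 = 0 then (1 : ZMod 4) else if m % 3 = 1 then -1 else 0)
      = t + thetaPos (ZMod 4) := by
    rw [thetaPos, ← theta_add]
    refine theta_congr (by simp) fun m hm ↦ ?_
    have : m % 3 = 0 ∨ m % 3 = 1 ∨ m % 3 = 2 := by omega
    rcases this with h | h | h
    · simp [show 3 ∣ m by omega, h, show -m % 3 = 0 by omega]
    · simp [show ¬ 3 ∣ m by omega, h, show -m % 3 = 2 by omega, hm, hm.not_gt]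
      decide
    · simp [show ¬ 3 ∣ m by omega, h, show -m % 3 = 1 by omega, hm, hm.not_gt]
      decide
  have h := genPD_mul_theta (R := ZMod 4) (c := fun m ↦ if Even m then (1 : ZMod 4) else -1)
    (c' := fun m ↦ if m % 3 = 0 then (1 : ZMod 4) else if m % 3 = 1 then -1 else 0)
    (fun m ↦ by
      simp only [Int.even_sub_one, Int.even_add_one]
      split_ifs <;> decide) (by simp)
    (fun m ↦ by
      have : m % 3 = 0 ∨ m % 3 = 1 ∨ m % 3 = 2 := by omega
      rcases this with h | h | h
      · simp [h, show (m - 1) % 3 = 2 by omega, show (m + 1) % 3 = 1 by omega]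
      · simp [h, show (m - 1) % 3 = 0 by omega, show (m + 1) % 3 = 2 by omega]
      · simp [h, show (m - 1) % 3 = 1 by omega, show (m + 1) % 3 = 0 by omega]) (by simp)
  rw [halt, hthree] at h
  linear_combination t * h + (1 - genPD (ZMod 4)) * ht

lemma coeff_thetaPos_mul_theta (n : ℕ) :
    coeff n (thetaPos R * theta (fun _ ↦ 1)) =
      (#{p ∈ Icc (-n : ℤ) n ×ˢ Icc (-n : ℤ) n |
        (0 < p.1 ∧ ¬ 3 ∣ p.1) ∧ n = p.1.natAbs ^ 2 + p.2.natAbs ^ 2} : R) := by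
  have h₁ := X_pow_dvd_theta_sub (fun m : ℤ ↦ if 0 < m ∧ ¬ 3 ∣ m then (1 : R) else 0) (le_refl n)
  have h₂ := X_pow_dvd_theta_sub (fun _ : ℤ ↦ (1 : R)) (le_refl n)
  rw [← thetaPos] at h₁
  have h := X_pow_dvd_iff.mp (dvd_mul_sub_mul h₁ h₂) n (Nat.lt_succ_self n)
  rw [map_sub, sub_eq_zero] at h
  rw [h, sum_mul_sum, ← sum_product', map_sum, ← sum_boole]
  refine sum_congr rfl fun p _ ↦ ?_
  by_cases hp : 0 < p.1 ∧ ¬ 3 ∣ p.1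
  · simp [hp, ← pow_add, coeff_X_pow]
  · simp [hp]

lemma card_sq_add_sq (n : ℕ) :
    Nat.card {p : ℕ × ℤ //
      1 ≤ p.1 ∧ ¬ 3 ∣ p.1 ∧ (n : ℤ) = (p.1 : ℤ) ^ 2 + p.2 ^ 2} =
    #{p ∈ Icc (-n : ℤ) n ×ˢ Icc (-n : ℤ) n |
      (0 < p.1 ∧ ¬ 3 ∣ p.1) ∧ n = p.1.natAbs ^ 2 + p.2.natAbs ^ 2} := by
  rw [← card_image_of_injOn (f := fun p : ℤ × ℤ ↦ (p.1.toNat, p.2))]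
  · refine Nat.subtype_card _ fun ⟨k, m⟩ ↦ ?_
    simp only [mem_image, mem_filter, mem_product, mem_Icc, Prod.mk.injEq, Prod.exists]
    constructor
    · rintro ⟨a, b, ⟨-, ⟨ha, ha'⟩, h⟩, rfl, rfl⟩
      refine ⟨by omega, by omega, ?_⟩
      rw [Int.toNat_of_nonneg ha.le, h]
      push_cast
      rw [sq_abs, sq_abs]
    · rintro ⟨hk, hk', h⟩
      have h' : n = (k : ℤ).natAbs ^ 2 + m.natAbs ^ 2 := by
        zify
        rw [sq_abs, sq_abs, h]
      have h₁ := Nat.le_self_pow two_ne_zero (k : ℤ).natAbs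
      have h₂ := Nat.le_self_pow two_ne_zero m.natAbs
      exact ⟨k, m, ⟨by omega, by omega, h'⟩, by simp, rfl⟩
  · rintro ⟨a, b⟩ ha ⟨a', b'⟩ ha' h
    simp only [coe_filter, Set.mem_ofPred_eq, Prod.mk.injEq] at ha ha' h
    exact Prod.ext (by omega) h.2

end DesignatedSummands

theorem stmt_13 (n : ℕ) (hn : 1 ≤ n) :
    PD 2 n ≡
      Nat.card {p : ℕ × ℤ //
        1 ≤ p.1 ∧ ¬ 3 ∣ p.1 ∧ (n : ℤ) = (p.1 : ℤ) ^ 2 + p.2 ^ 2} [MOD 4] := by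
  have h := congr_arg (PowerSeries.coeff n) DesignatedSummands.genPD_zmod_four
  rw [map_add, PowerSeries.coeff_one, if_neg (by omega), zero_add,
    DesignatedSummands.coeff_thetaPos_mul_theta, DesignatedSummands.genPD,
    PowerSeries.coeff_mk, ZMod.natCast_eq_natCast_iff] at h
  rwa [DesignatedSummands.card_sq_add_sq]
end
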